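/- Let a, b, s, t, n be positive integers with s + t = n, and set k = a + b + 1. Let X ⊆ ℝ² be a set of kn points in general position, partitioned into two color classes A and B with |A| = na + s and |B| = nb + t. Then there exist pairwise disjoint k-islands C₁, …, C_s, D₁, …, D_t spanned by X (so n islands in total, each containing exactly k points of X, with X ∩ C_j and X ∩ D_i equal to the points spanning them, and pairwise disjoint convex hulls) such that |C_j ∩ A| = a + 1 and |C_j ∩ B| = b for every j ∈ {1, …, s}, and |D_i ∩ A| = a and |D_i ∩ B| = b + 1 for every i ∈ {1, …, t}. -/

import Mathlib

noncomputable instance (d : ℕ) : DecidableEq (EuclideanSpace ℝ (Fin d)) := Classical.decEq _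

/-- A finite point set in `ℝ^d` is in general position if every subset
of size at most `d + 1` is affinely independent. -/
def GenPos (d : ℕ) (X : Finset (EuclideanSpace ℝ (Fin d))) : Prop :=
  ∀ S : Finset (EuclideanSpace ℝ (Fin d)), S ⊆ X → S.card ≤ d + 1 →
    AffineIndependent ℝ (fun p : S => (p : EuclideanSpace ℝ (Fin d)))


namespace NEP

/-- `u` and `v` cross the ray `{d₁ = d₂ < 0}`. -/
def Cross (u v : ℝ × ℝ) : Prop :=
  ((0 ≤ u.1 - u.2 ∧ v.1 - v.2 < 0) ∨ (0 ≤ v.1 - v.2 ∧ u.1 - u.2 < 0)) ∧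
    |u.1 - u.2| * (v.1 + v.2) + |v.1 - v.2| * (u.1 + u.2) < 0

/-- Zero is in the hull of three points. -/
def ZHull (u v w : ℝ × ℝ) : Prop :=
  ∃ a b c : ℝ, 0 ≤ a ∧ 0 ≤ b ∧ 0 ≤ c ∧ a + b + c = 1 ∧
    a * u.1 + b * v.1 + c * w.1 = 0 ∧ a * u.2 + b * v.2 + c * w.2 = 0

open Classical in
noncomputable def chi (u v : ℝ × ℝ) : ZMod 2 := if Cross u v then 1 else 0

lemma Cross.symm {u v : ℝ × ℝ} (h : Cross u v) : Cross v u := by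
  obtain ⟨h1, h2⟩ := h
  exact ⟨h1.symm, by linarith⟩

lemma cross_comm (u v : ℝ × ℝ) : Cross u v ↔ Cross v u := ⟨Cross.symm, Cross.symm⟩

lemma chi_comm (u v : ℝ × ℝ) : chi u v = chi v u := by
  unfold chi
  by_cases h : Cross u v
  · rw [if_pos h, if_pos h.symm]
  · rw [if_neg h, if_neg (fun h' => h h'.symm)]

lemma ZHull.of_pos {u v w : ℝ × ℝ} {a b c : ℝ} (ha : 0 ≤ a) (hb : 0 ≤ b) (hc : 0 ≤ c)
    (h : 0 < a + b + c) (h1 : a * u.1 + b * v.1 + c * w.1 = 0)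
    (h2 : a * u.2 + b * v.2 + c * w.2 = 0) : ZHull u v w := by
  refine ⟨a / (a+b+c), b / (a+b+c), c / (a+b+c), by positivity, by positivity, by positivity,
    by field_simp, ?_, ?_⟩
  · have : a / (a+b+c) * u.1 + b / (a+b+c) * v.1 + c / (a+b+c) * w.1
      = (a * u.1 + b * v.1 + c * w.1) / (a+b+c) := by ring
    rw [this, h1, zero_div]
  · have : a / (a+b+c) * u.2 + b / (a+b+c) * v.2 + c / (a+b+c) * w.2
      = (a * u.2 + b * v.2 + c * w.2) / (a+b+c) := by ring
    rw [this, h2, zero_div]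

lemma ZHull.swap12 {u v w : ℝ × ℝ} (h : ZHull u v w) : ZHull v u w := by
  obtain ⟨a, b, c, ha, hb, hc, h0, h1, h2⟩ := h
  exact ⟨b, a, c, hb, ha, hc, by linarith, by linarith, by linarith⟩

lemma ZHull.swap23 {u v w : ℝ × ℝ} (h : ZHull u v w) : ZHull u w v := by
  obtain ⟨a, b, c, ha, hb, hc, h0, h1, h2⟩ := h
  exact ⟨a, c, b, ha, hc, hb, by linarith, by linarith, by linarith⟩

lemma cross_aux {u v w : ℝ × ℝ} 
    (hs : (0 ≤ u.1 - u.2 ∧ 0 ≤ v.1 - v.2 ∧ w.1 - w.2 < 0) ∨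
      (u.1 - u.2 < 0 ∧ v.1 - v.2 < 0 ∧ 0 ≤ w.1 - w.2))
    (hc : Cross u w) (hn : ¬ Cross v w) : ZHull u v w := by
  have hc2 := hc.2
  have hn2 : 0 ≤ |v.1 - v.2| * (w.1 + w.2) + |w.1 - w.2| * (v.1 + v.2) := by
    by_contra hlt
    push Not at hlt
    exact hn ⟨by rcases hs with h | h <;> [left; right] <;> simp [h], hlt⟩
  have key : ∀ x y z : ℝ, 0 ≤ x → 0 ≤ y → 0 ≤ z → 
      |u.1 - u.2| = x → |v.1 - v.2| = y → |w.1 - w.2| = z →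
      (x * w.1 + z * u.1 = x * w.2 + z * u.2) → (y * w.1 + z * v.1 = y * w.2 + z * v.2) →
      (z = 0 → x * (w.1 + w.2) = 0) → ZHull u v w := by
    intro x y z hx hy hz ex ey ez h1 h2 h3
    rw [ex, ez] at hc2
    rw [ey, ez] at hn2
    have hzp : 0 < z := by
      rcases hz.eq_or_lt with h | h
      · have := h3 h.symm
        rw [← h] at hc2
        linarith
      · exact h
    have e1 : x * w.1 + z * u.1 = (x * (w.1 + w.2) + z * (u.1 + u.2)) / 2 := by linarith
    have e1' : x * w.2 + z * u.2 = (x * (w.1 + w.2) + z * (u.1 + u.2)) / 2 := by linarith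
    have e2 : y * w.1 + z * v.1 = (y * (w.1 + w.2) + z * (v.1 + v.2)) / 2 := by linarith
    have e2' : y * w.2 + z * v.2 = (y * (w.1 + w.2) + z * (v.1 + v.2)) / 2 := by linarith
    set P := x * (w.1 + w.2) + z * (u.1 + u.2)
    set Q := y * (w.1 + w.2) + z * (v.1 + v.2)
    have hP : 0 < -P := by linarith
    have : 0 < (-P) * z := by positivity
    refine ZHull.of_pos (a := Q * z) (b := (-P) * z) (c := Q * x + (-P) * y) 
      (by positivity) (by positivity) (by positivity) ?_ ?_ ?_
    · have : 0 ≤ Q * z := by positivity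
      have : 0 ≤ Q * x + (-P) * y := by positivity
      linarith
    · have : Q * z * u.1 + (-P) * z * v.1 + (Q * x + (-P) * y) * w.1 =
        Q * (x * w.1 + z * u.1) - P * (y * w.1 + z * v.1) := by ring
      rw [this, e1, e2]; ring
    · have : Q * z * u.2 + (-P) * z * v.2 + (Q * x + (-P) * y) * w.2 =
        Q * (x * w.2 + z * u.2) - P * (y * w.2 + z * v.2) := by ring
      rw [this, e1', e2']; ring
  rcases hs with ⟨h1, h2, h3⟩ | ⟨h1, h2, h3⟩
  · refine key _ _ _ h1 h2 (neg_nonneg.2 h3.le) (abs_of_nonneg h1) (abs_of_nonneg h2)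
      (abs_of_neg h3) (by ring) (by ring) (by intro h; linarith)
  · by_cases hw : w.1 - w.2 = 0
    · -- then the crossing point is `w` itself
      rw [hw, abs_zero, zero_mul, add_zero] at hc2 hn2
      exfalso
      have := abs_pos.2 h1.ne
      have := abs_pos.2 h2.ne
      have : w.1 + w.2 < 0 := by by_contra hh; push Not at hh; nlinarith
      nlinarith
    · refine key _ _ _ (neg_nonneg.2 h1.le) (neg_nonneg.2 h2.le) h3 (abs_of_neg h1)
        (abs_of_neg h2) (abs_of_nonneg h3) (by ring) (by ring) (by intro h; exact absurd h hw)

lemma chi_same {u v : ℝ × ℝ} (h : (0 ≤ u.1 - u.2) ↔ (0 ≤ v.1 - v.2)) : chi u v = 0 := by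
  unfold chi
  rw [if_neg]
  rintro ⟨h1 | h1, -⟩
  · exact absurd (h.1 h1.1) (not_le.2 h1.2)
  · exact absurd (h.2 h1.1) (not_le.2 h1.2)

lemma zmod2_add_self (x : ZMod 2) : x + x = 0 := CharTwo.add_self_eq_zero x

lemma chi_eq_of {u v w : ℝ × ℝ} 
    (hs : (0 ≤ u.1 - u.2 ∧ 0 ≤ v.1 - v.2 ∧ w.1 - w.2 < 0) ∨
      (u.1 - u.2 < 0 ∧ v.1 - v.2 < 0 ∧ 0 ≤ w.1 - w.2))
    (h : ¬ ZHull u v w) : chi u w = chi v w := by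
  have : Cross u w ↔ Cross v w := by
    constructor
    · intro hc
      by_contra hn
      exact h (cross_aux hs hc hn)
    · intro hc
      by_contra hn
      exact h (cross_aux (by tauto) hc hn).swap12
  unfold chi
  by_cases h : Cross u w
  · rw [if_pos h, if_pos (this.1 h)]
  · rw [if_neg h, if_neg (fun h' => h (this.2 h'))]

lemma tri {u v w : ℝ × ℝ} (h : ¬ ZHull u v w) : chi u v + chi v w + chi u w = 0 := by
  have aux : ∀ {u v w : ℝ × ℝ}, ¬ ZHull u v w → ((0 ≤ u.1 - u.2) ↔ (0 ≤ v.1 - v.2)) → 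
      chi u v + chi v w + chi u w = 0 := by
    intro u v w h huv
    rw [chi_same huv, zero_add]
    by_cases hw : (0 ≤ v.1 - v.2) ↔ (0 ≤ w.1 - w.2)
    · rw [chi_same hw, chi_same (huv.trans hw), add_zero]
    · rw [chi_eq_of _ h, zmod2_add_self]
      by_cases h1 : 0 ≤ v.1 - v.2
      · left; exact ⟨huv.2 h1, h1, by by_contra; apply hw; simp_all⟩
      · right; refine ⟨not_le.1 (fun h => h1 (huv.1 h)), not_le.1 h1, by by_contra; apply hw; tauto⟩
  by_cases h1 : (0 ≤ u.1 - u.2) ↔ (0 ≤ v.1 - v.2)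
  · exact aux h h1
  by_cases h2 : (0 ≤ v.1 - v.2) ↔ (0 ≤ w.1 - w.2)
  · have := aux (u := v) (v := w) (w := u) (fun hh => h (hh.swap23.swap12)) h2
    rw [chi_comm w u, chi_comm v u] at this
    rw [← this]; ring
  · have := aux (u := u) (v := w) (w := v) (fun hh => h (hh.swap23)) (by tauto)
    rw [chi_comm w v] at this
    rw [← this]; ring

lemma chi_pos {u v : ℝ × ℝ} (hu : 0 < u.1 + u.2) (hv : 0 < v.1 + v.2) : chi u v = 0 := by
  unfold chi
  rw [if_neg]
  rintro ⟨-, h⟩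
  have : 0 ≤ |u.1 - u.2| * (v.1 + v.2) := by positivity
  have : 0 ≤ |v.1 - v.2| * (u.1 + u.2) := by positivity
  linarith

open Classical in
noncomputable def sd (u : ℝ × ℝ) : ZMod 2 := if 0 ≤ u.1 - u.2 then 1 else 0

lemma chi_half {u v : ℝ × ℝ} (h : (u.1 < 0 ∧ v.1 < 0) ∨ (u.2 < 0 ∧ v.2 < 0)) :
    chi u v = sd u + sd v := by
  have key : ∀ {u v : ℝ × ℝ}, ((u.1 < 0 ∧ v.1 < 0) ∨ (u.2 < 0 ∧ v.2 < 0)) → 0 ≤ u.1 - u.2 → 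
      v.1 - v.2 < 0 → chi u v = 1 := by
    intro u v h h1 h2
    unfold chi
    rw [if_pos]
    refine ⟨Or.inl ⟨h1, h2⟩, ?_⟩
    rw [abs_of_nonneg h1, abs_of_neg h2]
    rcases h with ⟨h3, h4⟩ | ⟨h3, h4⟩ <;> nlinarith
  by_cases h1 : 0 ≤ u.1 - u.2 <;> by_cases h2 : 0 ≤ v.1 - v.2
  · rw [chi_same (by tauto)]; simp [sd, h1, h2]; decide
  · rw [key h h1 (not_le.1 h2)]; simp only [sd, h1, h2]; simp
  · rw [chi_comm, key (by tauto) h2 (not_le.1 h1)]; simp only [sd, h1, h2]; simp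
  · rw [chi_same (by tauto)]; simp only [sd, h1, h2]; simp

lemma grid (d : ℕ → ℕ → ℝ × ℝ) (M N : ℕ)
    (h1 : ∀ i < M, ∀ j < N, ¬ ZHull (d i j) (d (i+1) j) (d i (j+1)))
    (h2 : ∀ i < M, ∀ j < N, ¬ ZHull (d (i+1) j) (d i (j+1)) (d (i+1) (j+1)))
    (hl : ∀ j < N, chi (d 0 j) (d 0 (j+1)) = 0)
    (hr : ∀ j < N, chi (d M j) (d M (j+1)) = 0)
    (ht : ∀ i < M, chi (d i N) (d (i+1) N) = 0) :
    ∑ i ∈ Finset.range M, chi (d i 0) (d (i+1) 0) = 0 := by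
  have sq : ∀ i < M, ∀ j < N, chi (d i j) (d (i+1) j) + chi (d i (j+1)) (d (i+1) (j+1)) =
      chi (d (i+1) j) (d (i+1) (j+1)) - chi (d i j) (d i (j+1)) := by
    intro i hi j hj
    have a := tri (h1 i hi j hj)
    have b := tri (h2 i hi j hj)
    have c := zmod2_add_self (chi (d (i+1) j) (d i (j+1)))
    have e := zmod2_add_self (chi (d i j) (d i (j+1)))
    have f := zmod2_add_self (chi (d (i+1) j) (d (i+1) (j+1)))
    linear_combination a + b - c - f
  have row : ∀ j ≤ N, ∑ i ∈ Finset.range M, chi (d i 0) (d (i+1) 0) =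
      ∑ i ∈ Finset.range M, chi (d i j) (d (i+1) j) := by
    intro j
    induction j with
    | zero => intro _; rfl
    | succ j ih =>
      intro hj
      rw [ih (by omega)]
      have : ∑ i ∈ Finset.range M, (chi (d i j) (d (i+1) j) + chi (d i (j+1)) (d (i+1) (j+1))) = 0 := by
        rw [Finset.sum_congr rfl (fun i hi => sq i (Finset.mem_range.1 hi) j (by omega)),
          Finset.sum_range_sub (fun i => chi (d i j) (d i (j+1))), hl j (by omega), hr j (by omega), sub_zero]
      rw [Finset.sum_add_distrib] at this
      have c := zmod2_add_self (∑ i ∈ Finset.range M, chi (d i (j+1)) (d (i+1) (j+1)))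
      linear_combination this - c
  rw [row N le_rfl]
  exact Finset.sum_eq_zero (fun i hi => ht i (Finset.mem_range.1 hi))

/-- the parity theorem on a fixed grid -/
lemma grid_main (d : ℕ → ℕ → ℝ × ℝ) (N : ℕ) (hN : 3 ≤ N)
    (hl : ∀ j ≤ N, 0 < (d 0 j).1 + (d 0 j).2)
    (hr : ∀ j ≤ N, 0 < (d (2*N) j).1 + (d (2*N) j).2)
    (ht : ∀ i ≤ 2 * N, 0 < (d i N).1 + (d i N).2)
    (hb1 : ∀ i, 0 < i → i ≤ N → (d i 0).2 < 0)
    (hb2 : ∀ i, N ≤ i → i < 2 * N → (d i 0).1 < 0)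
    (hc1 : 0 < (d 1 0).1 + (d 1 0).2)
    (hc2 : 0 < (d (2*N-1) 0).1 + (d (2*N-1) 0).2) :
    ∃ i < 2 * N, ∃ j < N, ZHull (d i j) (d (i+1) j) (d i (j+1)) ∨
      ZHull (d (i+1) j) (d i (j+1)) (d (i+1) (j+1)) := by
  by_contra hcon
  push Not at hcon
  have h0 := grid d (2*N) N (fun i hi j hj => (hcon i hi j hj).1) (fun i hi j hj => (hcon i hi j hj).2)
    (fun j hj => chi_pos (hl _ (by omega)) (hl _ (by omega)))
    (fun j hj => chi_pos (hr _ (by omega)) (hr _ (by omega)))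
    (fun i hi => chi_pos (ht _ (by omega)) (ht _ (by omega)))
  obtain ⟨K, hK⟩ : ∃ K, 2 * N = K + 2 := ⟨2*N-2, by omega⟩
  rw [hK, Finset.sum_range_succ, Finset.sum_range_succ'] at h0
  have e1 : chi (d 0 0) (d (0+1) 0) = 0 := chi_pos (hl _ (by omega)) (by simpa using hc1)
  have e2 : chi (d (K+1) 0) (d (K+1+1) 0) = 0 := by
    apply chi_pos
    · rw [show 2 * N - 1 = K + 1 by omega] at hc2; exact hc2
    · have := hr 0 (by omega)
      rw [hK] at this; exact this
  have e3 : ∑ i ∈ Finset.range K, chi (d (i+1) 0) (d (i+1+1) 0) = sd (d (K+1) 0) - sd (d 1 0) := by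
    rw [show sd (d (K+1) 0) - sd (d 1 0) = ∑ i ∈ Finset.range K, (sd (d (i+1+1) 0) - sd (d (i+1) 0))
      from (Finset.sum_range_sub (fun i => sd (d (i+1) 0)) K).symm]
    apply Finset.sum_congr rfl
    intro i hi
    have hi := Finset.mem_range.1 hi
    rw [chi_half]
    · have := zmod2_add_self (sd (d (i+1) 0))
      linear_combination this
    · by_cases h : i + 1 + 1 ≤ N
      · right; exact ⟨hb1 _ (by omega) (by omega), hb1 _ (by omega) h⟩
      · left; exact ⟨hb2 _ (by omega) (by omega), hb2 _ (by omega) (by omega)⟩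
  rw [e1, e2, e3] at h0
  have s1 : sd (d 1 0) = 1 := by
    have := hb1 1 (by omega) (by omega)
    unfold sd
    rw [if_pos]; linarith
  have s2 : sd (d (K+1) 0) = 0 := by
    have := hb2 (K+1) (by omega) (by omega)
    rw [show 2 * N - 1 = K + 1 by omega] at hc2
    unfold sd
    rw [if_neg]; linarith
  rw [s1, s2] at h0
  revert h0; decide

lemma topo {Φ : Type*} [Finite Φ] (δ : Φ → ℝ × ℝ) (O : Φ → Set (ℝ × ℝ))
    (hO : ∀ f, IsClosed (O f))
    (hex : ∀ z : ℝ × ℝ, z ∈ Set.Icc (-1:ℝ) 1 ×ˢ Set.Icc (0:ℝ) 1 → ∃ f, z ∈ O f)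
    (h1 : ∀ f, ∀ z ∈ O f, z ∈ Set.Icc (-1:ℝ) 1 ×ˢ Set.Icc (0:ℝ) 1 → 
      (z.1 = -1 ∨ z.1 = 1 ∨ z.2 = 1) → 0 < (δ f).1 + (δ f).2)
    (h2 : ∀ f, ∀ z ∈ O f, z.2 = 0 → -1 < z.1 → z.1 ≤ 0 → (δ f).2 < 0)
    (h3 : ∀ f, ∀ z ∈ O f, z.2 = 0 → 0 ≤ z.1 → z.1 < 1 → (δ f).1 < 0)
    (h4 : ∀ f, ∀ z ∈ O f, z.2 = 0 → -1 < z.1 → z.1 < -1/2 → 0 < (δ f).1 + (δ f).2)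
    (h5 : ∀ f, ∀ z ∈ O f, z.2 = 0 → 1/2 < z.1 → z.1 < 1 → 0 < (δ f).1 + (δ f).2) :
    ∃ z ∈ Set.Icc (-1:ℝ) 1 ×ˢ Set.Icc (0:ℝ) 1, ∃ f g h, z ∈ O f ∧ z ∈ O g ∧ z ∈ O h ∧ 
      ZHull (δ f) (δ g) (δ h) := by
  classical
  set K : Set (ℝ × ℝ) := Set.Icc (-1:ℝ) 1 ×ˢ Set.Icc (0:ℝ) 1 with hK
  have hKc : IsCompact K := isCompact_Icc.prod isCompact_Icc
  let S : Set ((ℝ × ℝ) × (ℝ × ℝ) × (ℝ × ℝ)) :=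
    (K ×ˢ (K ×ˢ K)) ∩ ⋃ t : {t : Φ × Φ × Φ // ZHull (δ t.1) (δ t.2.1) (δ t.2.2)},
      (O t.1.1 ×ˢ (O t.1.2.1 ×ˢ O t.1.2.2))
  have hS : IsCompact S := by
    apply (hKc.prod (hKc.prod hKc)).inter_right
    exact isClosed_iUnion_of_finite (fun t => (hO _).prod ((hO _).prod (hO _)))
  have hgrid : ∀ N : ℕ, 3 ≤ N → ∃ p ∈ S, dist p.1 p.2.1 + dist p.1 p.2.2 ≤ 4 / N := by
    intro N hN
    have hNr : (0:ℝ) < N := by exact_mod_cast (by omega : 0 < N)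
    have hN3 : (3:ℝ) ≤ N := by exact_mod_cast hN
    let z : ℕ → ℕ → ℝ × ℝ := fun i j => (((i:ℝ) - N) / N, (j:ℝ) / N)
    have hz : ∀ i ≤ 2 * N, ∀ j ≤ N, z i j ∈ K := by
      intro i hi j hj
      have hi' : (i:ℝ) ≤ 2 * N := by exact_mod_cast hi
      have hj' : (j:ℝ) ≤ N := by exact_mod_cast hj
      refine ⟨⟨?_, ?_⟩, ?_, ?_⟩
      · show -1 ≤ ((i:ℝ) - N) / N
        rw [le_div_iff₀ hNr]; linarith [Nat.cast_nonneg (α := ℝ) i]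
      · show ((i:ℝ) - N) / N ≤ 1
        rw [div_le_iff₀ hNr]; linarith
      · show 0 ≤ (j:ℝ) / N
        positivity
      · show (j:ℝ) / N ≤ 1
        rw [div_le_iff₀ hNr]; linarith
    have hF : ∀ i j, ∃ f, z i j ∈ K → z i j ∈ O f := by
      intro i j
      by_cases h : z i j ∈ K
      · obtain ⟨f, hf⟩ := hex _ h
        exact ⟨f, fun _ => hf⟩
      · obtain ⟨f, hf⟩ := hex (0, 0) (by simp [hK])
        exact ⟨f, fun h' => absurd h' h⟩
    choose F hF using hF
    have hFO : ∀ i ≤ 2 * N, ∀ j ≤ N, z i j ∈ O (F i j) := fun i hi j hj => hF i j (hz i hi j hj)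
    have hd1 : ∀ i j, dist (z i j) (z (i+1) j) ≤ 1 / N := by
      intro i j
      simp only [z, Prod.dist_eq, dist_self, Real.dist_eq]
      rw [max_le_iff]
      refine ⟨?_, by positivity⟩
      rw [show ((i:ℝ) - N) / N - (((i+1 : ℕ):ℝ) - N) / N = - (1 / N) by push_cast; field_simp; ring, abs_neg,
        abs_of_pos (by positivity)]
    have hd2 : ∀ i j, dist (z i j) (z i (j+1)) ≤ 1 / N := by
      intro i j
      simp only [z, Prod.dist_eq, dist_self, Real.dist_eq]
      rw [max_le_iff]
      refine ⟨by positivity, ?_⟩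
      rw [show ((j:ℝ)) / N - (((j+1 : ℕ):ℝ)) / N = - (1 / N) by push_cast; field_simp; ring, abs_neg,
        abs_of_pos (by positivity)]
    obtain ⟨i, hi, j, hj, h⟩ := grid_main (fun i j => δ (F i j)) N hN
      (fun j hj => h1 _ _ (hFO 0 (by omega) j hj) (hz _ (by omega) _ hj) (by left; simp [z]; field_simp))
      (fun j hj => h1 _ _ (hFO (2*N) le_rfl j hj) (hz _ le_rfl _ hj)
        (by right; left; simp [z]; field_simp; ring))
      (fun i hi => h1 _ _ (hFO i hi N le_rfl) (hz _ hi _ le_rfl) (by right; right; exact div_self hNr.ne'))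
      (fun i hi hi' => h2 _ _ (hFO i (by omega) 0 (by omega)) (by simp [z])
        (by
          have : (0:ℝ) < i := by exact_mod_cast hi
          show -1 < ((i:ℝ) - N) / N
          rw [lt_div_iff₀ hNr]; linarith)
        (by
          have : (i:ℝ) ≤ N := by exact_mod_cast hi'
          show ((i:ℝ) - N) / N ≤ 0
          rw [div_le_iff₀ hNr]; linarith))
      (fun i hi hi' => h3 _ _ (hFO i (by omega) 0 (by omega)) (by simp [z])
        (by
          have : (N:ℝ) ≤ i := by exact_mod_cast hi
          show 0 ≤ ((i:ℝ) - N) / N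
          rw [le_div_iff₀ hNr]; linarith)
        (by
          have : (i:ℝ) < 2 * N := by exact_mod_cast hi'
          show ((i:ℝ) - N) / N < 1
          rw [div_lt_iff₀ hNr]; linarith))
      (h4 _ _ (hFO 1 (by omega) 0 (by omega)) (by simp [z])
        (by
          show -1 < (((1:ℕ):ℝ) - N) / N
          rw [lt_div_iff₀ hNr]; push_cast; linarith)
        (by
          show (((1:ℕ):ℝ) - N) / N < -1/2
          rw [div_lt_iff₀ hNr]; push_cast; linarith))
      (h5 _ _ (hFO (2*N-1) (by omega) 0 (by omega)) (by simp [z])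
        (by
          show 1/2 < (((2*N-1:ℕ):ℝ) - N) / N
          rw [lt_div_iff₀ hNr, Nat.cast_sub (by omega)]; push_cast; linarith)
        (by
          show (((2*N-1:ℕ):ℝ) - N) / N < 1
          rw [div_lt_iff₀ hNr, Nat.cast_sub (by omega)]; push_cast; linarith))
    have h14 : (4:ℝ) / N = 1/N + 1/N + 1/N + 1/N := by ring
    have hpos : (0:ℝ) < 1 / N := by positivity
    rcases h with h | h
    · refine ⟨(z i j, z (i+1) j, z i (j+1)), ⟨⟨hz _ (by omega) _ (by omega), hz _ (by omega) _ (by omega), hz _ (by omega) _ (by omega)⟩,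
        Set.mem_iUnion.2 ⟨⟨(F i j, F (i+1) j, F i (j+1)), h⟩, hFO _ (by omega) _ (by omega), hFO _ (by omega) _ (by omega), hFO _ (by omega) _ (by omega)⟩⟩, ?_⟩
      have := hd1 i j
      have := hd2 i j
      simp only
      linarith
    · refine ⟨(z (i+1) j, z i (j+1), z (i+1) (j+1)), ⟨⟨hz _ (by omega) _ (by omega), hz _ (by omega) _ (by omega), hz _ (by omega) _ (by omega)⟩,
        Set.mem_iUnion.2 ⟨⟨(F (i+1) j, F i (j+1), F (i+1) (j+1)), h⟩, hFO _ (by omega) _ (by omega), hFO _ (by omega) _ (by omega), hFO _ (by omega) _ (by omega)⟩⟩, ?_⟩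
      have a1 := hd1 i j
      have a2 := hd2 i j
      have a3 := hd2 (i+1) j
      have a4 := dist_triangle (z (i+1) j) (z i j) (z i (j+1))
      rw [dist_comm (z (i+1) j) (z i j)] at a4
      simp only
      linarith
  obtain ⟨p0, hp0, -⟩ := hgrid 3 le_rfl
  obtain ⟨p, hp, hmin⟩ := hS.exists_isMinOn ⟨p0, hp0⟩
    (f := fun p => dist p.1 p.2.1 + dist p.1 p.2.2) (by fun_prop)
  have hzero : dist p.1 p.2.1 + dist p.1 p.2.2 ≤ 0 := by
    by_contra hpos
    push Not at hpos
    obtain ⟨N, hN⟩ := exists_nat_gt (4 / (dist p.1 p.2.1 + dist p.1 p.2.2))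
    obtain ⟨q, hq, hq'⟩ := hgrid (max N 3) (le_max_right _ _)
    have := hmin hq
    have this : dist p.1 p.2.1 + dist p.1 p.2.2 ≤ dist q.1 q.2.1 + dist q.1 q.2.2 := this
    have hNN : (N:ℝ) ≤ (max N 3 : ℕ) := by exact_mod_cast le_max_left _ _
    have h3 : (0:ℝ) < (max N 3 : ℕ) := by exact_mod_cast (by omega)
    rw [div_lt_iff₀ hpos] at hN
    have := this.trans hq'
    rw [le_div_iff₀ h3] at this
    nlinarith
  have d1 : p.1 = p.2.1 := dist_le_zero.1 (by linarith [dist_nonneg (x := p.1) (y := p.2.2)])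
  have d2 : p.1 = p.2.2 := dist_le_zero.1 (by linarith [dist_nonneg (x := p.1) (y := p.2.1)])
  obtain ⟨⟨hk, -⟩, hu⟩ := hp
  obtain ⟨⟨t, ht⟩, ho1, ho2, ho3⟩ := Set.mem_iUnion.1 hu
  exact ⟨p.1, hk, t.1, t.2.1, t.2.2, ho1, d1 ▸ ho2, d2 ▸ ho3, ht⟩

end NEP


namespace NEP
set_option linter.unusedSectionVars false
open Finset

lemma birk {ι P : Type*} [Fintype P] [DecidableEq P] [Nonempty P] [DecidableEq ι] (Y : Finset ι)
    (c G : ι → P → ℝ) (N : P → ℕ) (hG : ∀ y ∈ Y, ∀ p, 0 ≤ G y p)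
    (hrow : ∀ y ∈ Y, ∑ p, G y p = 1) (hcol : ∀ p, ∑ y ∈ Y, G y p = N p) :
    ∃ f : ι → P, (∀ p, (Y.filter (fun y => f y = p)).card = N p) ∧
      ∑ y ∈ Y, ∑ p, c y p * G y p ≤ ∑ y ∈ Y, c y (f y) := by
  classical
  have hcard : Fintype.card Y = Fintype.card (Σ p, Fin (N p)) := by
    have : ((Y.card : ℕ) : ℝ) = ((∑ p, N p : ℕ) : ℝ) := by
      push_cast
      rw [← Finset.sum_congr rfl (fun p _ => hcol p), Finset.sum_comm, Finset.sum_congr rfl hrow]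
      simp
    simp only [Fintype.card_coe, Fintype.card_sigma, Fintype.card_fin]
    exact_mod_cast this
  let e : Y ≃ (Σ p, Fin (N p)) := Fintype.equivOfCardEq hcard
  have sumslot : ∀ h : P → ℝ, ∑ y : Y, h (e y).1 = ∑ p, N p * h p := by
    intro h
    rw [e.sum_comp (fun s => h s.1), Fintype.sum_sigma]
    simp
  have hmul : ∀ y ∈ Y, ∀ p, (N p : ℝ) * (G y p / N p) = G y p := by
    intro y hy p
    by_cases h : (N p : ℝ) = 0
    · have := hcol p
      rw [h] at this
      rw [(Finset.sum_eq_zero_iff_of_nonneg (fun y hy => hG y hy p)).1 this y hy, h, zero_mul]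
    · field_simp
  let M : Matrix Y Y ℝ := fun x y => G x (e y).1 / N (e y).1
  have hM : M ∈ doublyStochastic ℝ Y := by
    rw [mem_doublyStochastic_iff_sum]
    refine ⟨fun x y => div_nonneg (hG x x.2 _) (Nat.cast_nonneg _), fun x => ?_, fun y => ?_⟩
    · show ∑ y : Y, G x (e y).1 / N (e y).1 = 1
      rw [sumslot (fun p => G x p / N p), Finset.sum_congr rfl (fun p _ => hmul x x.2 p)]
      exact hrow x x.2
    · show ∑ x : Y, G x (e y).1 / N (e y).1 = 1
      rw [← Finset.sum_div, Finset.sum_coe_sort Y (fun x => G x (e y).1), hcol, div_self]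
      have := (e y).2.pos
      exact_mod_cast this.ne'
  let φ : Matrix Y Y ℝ →ₗ[ℝ] ℝ :=
    { toFun := fun M => ∑ x : Y, ∑ y : Y, M x y * c x (e y).1
      map_add' := by intro A B; simp [add_mul, Finset.sum_add_distrib]
      map_smul' := by intro r A; simp [mul_assoc, Finset.mul_sum] }
  have hφ : ConvexOn ℝ Set.univ φ := φ.convexOn convex_univ
  have hM' : M ∈ convexHull ℝ {σ.permMatrix ℝ | σ : Equiv.Perm Y} := by
    rw [← doublyStochastic_eq_convexHull_permMatrix]; exact hM
  obtain ⟨_, ⟨σ, rfl⟩, hσ⟩ := hφ.exists_ge_of_mem_convexHull (Set.subset_univ _) hM'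
  have e1 : φ M = ∑ y ∈ Y, ∑ p, c y p * G y p := by
    show ∑ x : Y, ∑ y : Y, G x (e y).1 / N (e y).1 * c x (e y).1 = _
    rw [← Finset.sum_coe_sort Y (fun y => ∑ p, c y p * G y p)]
    apply Finset.sum_congr rfl
    intro x _
    rw [sumslot (fun p => G x p / N p * c x p)]
    apply Finset.sum_congr rfl
    intro p _
    rw [← mul_assoc, hmul x x.2 p, mul_comm]
  have e2 : φ (σ.permMatrix ℝ) = ∑ y : Y, c y (e (σ y)).1 := by
    show ∑ x : Y, ∑ y : Y, σ.permMatrix ℝ x y * c x (e y).1 = _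
    apply Finset.sum_congr rfl
    intro x _
    simp [Equiv.Perm.permMatrix, PEquiv.toMatrix_apply]
  refine ⟨fun y => if h : y ∈ Y then (e (σ ⟨y, h⟩)).1 else Classical.arbitrary P, ?_, ?_⟩
  · intro p
    have : (Y.filter (fun y => (if h : y ∈ Y then (e (σ ⟨y, h⟩)).1 else Classical.arbitrary P) = p)).card
        = (univ.filter (fun s : Σ p, Fin (N p) => s.1 = p)).card := by
      symm
      apply Finset.card_bij (fun s _ => ((σ.symm (e.symm s) : Y) : ι))
      · intro s hs
        simp only [mem_filter, mem_univ, true_and] at hs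
        simp [hs]
      · intro s _ s' _ h
        simpa using h
      · intro y hy
        simp only [mem_filter] at hy
        obtain ⟨hy, hp⟩ := hy
        rw [dif_pos hy] at hp
        exact ⟨e (σ ⟨y, hy⟩), by simp [hp], by simp⟩
    rw [this]
    have h2 : (univ.filter (fun s : Σ p, Fin (N p) => s.1 = p)) =
      (univ : Finset (Fin (N p))).map ⟨fun i => ⟨p, i⟩, fun i j h => by simpa using h⟩ := by
      ext ⟨q, i⟩
      simp only [mem_filter, mem_univ, true_and, mem_map]
      constructor
      · rintro rfl; exact ⟨i, rfl⟩
      · rintro ⟨j, hj⟩; exact (congrArg Sigma.fst hj).symm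
    rw [h2]; simp
  · rw [← e1, ← Finset.sum_coe_sort Y]
    refine hσ.trans (le_of_eq ?_)
    rw [e2]
    apply Finset.sum_congr rfl
    intro y _
    simp

variable {ι P E : Type*} [Fintype ι] [DecidableEq ι] [Fintype P] [DecidableEq P]
  [NormedAddCommGroup E] [InnerProductSpace ℝ E]

def Feas (N : P → ℕ) (f : ι → P) : Prop := ∀ p, (univ.filter (fun x => f x = p)).card = N p

noncomputable def cost (pos : ι → E) (v : P → E) (f : ι → P) : ℝ := ∑ x, inner ℝ (pos x) (v (f x))

def Opt (pos : ι → E) (N : P → ℕ) (v : P → E) (f : ι → P) : Prop :=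
  Feas N f ∧ ∀ g, Feas N g → cost pos v g ≤ cost pos v f

lemma exists_feas (N : P → ℕ) (h : ∑ p, N p = Fintype.card ι) : ∃ f : ι → P, Feas N f := by
  classical
  have hcard : Fintype.card ι = Fintype.card (Σ p, Fin (N p)) := by
    simp [h]
  let e := Fintype.equivOfCardEq hcard
  refine ⟨fun x => (e x).1, fun p => ?_⟩
  have : (univ.filter (fun x => (e x).1 = p)) = 
      (univ : Finset (Fin (N p))).map ⟨fun i => e.symm ⟨p, i⟩, fun i j h => by simpa using h⟩ := by
    ext x
    simp only [mem_filter, mem_univ, true_and, mem_map]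
    constructor
    · intro hx; subst hx; exact ⟨(e x).2, e.symm_apply_apply x⟩
    · rintro ⟨j, rfl⟩
      show (e (e.symm ⟨p, j⟩)).1 = p
      rw [e.apply_symm_apply]
  rw [this]; simp

lemma exists_opt (pos : ι → E) (N : P → ℕ) (v : P → E) (h : ∑ p, N p = Fintype.card ι) :
    ∃ f : ι → P, Opt pos N v f := by
  classical
  obtain ⟨f0, hf0⟩ := exists_feas (ι := ι) N h
  obtain ⟨f, hf, hmax⟩ := Finset.exists_max_image (univ.filter (fun f : ι → P => Feas N f)) (cost pos v)
    ⟨f0, by simp [hf0]⟩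
  exact ⟨f, by simpa using hf, fun g hg => hmax g (by simp [hg])⟩

lemma isClosed_opt (pos : ι → E) (N : P → ℕ) (f : ι → P) : IsClosed {v : P → E | Opt pos N v f} := by
  have hc : ∀ g : ι → P, Continuous (fun v : P → E => cost pos v g) := by
    intro g; unfold cost; fun_prop
  by_cases hf : Feas N f
  · have : {v : P → E | Opt pos N v f} = ⋂ g : ι → P, {v | Feas N g → cost pos v g ≤ cost pos v f} := by
      ext v; simp [Opt, hf]
    rw [this]
    refine isClosed_iInter (fun g => ?_)
    by_cases hg : Feas N g
    · simp only [hg, true_imp_iff]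
      exact isClosed_le (hc g) (hc f)
    · simp [hg]
  · simp [Opt, hf]

lemma Opt.swap {pos : ι → E} {N : P → ℕ} {v : P → E} {f : ι → P} (h : Opt pos N v f) (x y : ι) :
    inner ℝ (pos y) (v (f x) - v (f y)) ≤ inner ℝ (pos x) (v (f x) - v (f y)) := by
  by_cases hxy : x = y
  · subst hxy; rfl
  have hg : Feas N (f ∘ Equiv.swap x y) := by
    intro p
    rw [← h.1 p]
    apply Finset.card_bij (fun z _ => Equiv.swap x y z)
    · intro z hz; simpa using hz
    · intro z _ z' _ h; simpa using h
    · intro z hz; exact ⟨Equiv.swap x y z, by simpa using hz, by simp⟩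
  have := h.2 _ hg
  unfold cost at this
  rw [← Finset.add_sum_erase _ _ (mem_univ x), ← Finset.add_sum_erase _ _ (mem_univ x),
    ← Finset.add_sum_erase _ _ (mem_erase.2 ⟨Ne.symm hxy, mem_univ y⟩),
    ← Finset.add_sum_erase _ _ (mem_erase.2 ⟨Ne.symm hxy, mem_univ y⟩)] at this
  have e : ∑ z ∈ (univ.erase x).erase y, inner ℝ (pos z) (v ((f ∘ Equiv.swap x y) z)) =
      ∑ z ∈ (univ.erase x).erase y, inner ℝ (pos z) (v (f z)) := by
    apply Finset.sum_congr rfl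
    intro z hz
    simp only [mem_erase] at hz
    simp [Equiv.swap_apply_of_ne_of_ne hz.2.1 hz.1]
  rw [e] at this
  simp only [Function.comp_apply, Equiv.swap_apply_left, Equiv.swap_apply_right] at this
  rw [inner_sub_right, inner_sub_right]
  linarith

lemma round {κ : Type*} [Fintype κ] [Nonempty P] {pos : ι → E} {N : P → ℕ} {v : P → E} (f : κ → ι → P)
    (hf : ∀ k, Opt pos N v (f k)) (w : κ → ℝ) (hw : ∀ k, 0 ≤ w k) (hw1 : ∑ k, w k = 1)
    (A : Finset ι) (T : P → ℕ)
    (hT : ∀ p, ∑ k, w k * ((A.filter (fun x => f k x = p)).card : ℝ) = T p) :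
    ∃ g, Opt pos N v g ∧ ∀ p, (A.filter (fun x => g x = p)).card = T p := by
  classical
  have hκ : Nonempty κ := by
    by_contra h
    rw [not_nonempty_iff] at h
    simp at hw1
  obtain ⟨k0⟩ := hκ
  have hsplit : ∀ (g : ι → P) p, (A.filter (fun x => g x = p)).card + (Aᶜ.filter (fun x => g x = p)).card
      = (univ.filter (fun x => g x = p)).card := by
    intro g p
    rw [← Finset.card_union_of_disjoint, ← Finset.filter_union, Finset.union_compl]
    exact Finset.disjoint_filter_filter disjoint_compl_right
  let G : ι → P → ℝ := fun x p => ∑ k, w k * (if f k x = p then 1 else 0)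
  have hG : ∀ x p, 0 ≤ G x p := fun x p => Finset.sum_nonneg (fun k _ => mul_nonneg (hw k) (by split_ifs <;> norm_num))
  have hrow : ∀ x, ∑ p, G x p = 1 := by
    intro x
    simp only [G]
    rw [Finset.sum_comm]
    refine Eq.trans ?_ hw1
    apply Finset.sum_congr rfl
    intro k _
    rw [← Finset.mul_sum]; simp
  have hcol : ∀ (Y : Finset ι) p, ∑ x ∈ Y, G x p = ∑ k, w k * ((Y.filter (fun x => f k x = p)).card : ℝ) := by
    intro Y p
    simp only [G]
    rw [Finset.sum_comm]
    apply Finset.sum_congr rfl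
    intro k _
    rw [← Finset.mul_sum]; simp
  have hcolB : ∀ p, ∑ x ∈ Aᶜ, G x p = (N p : ℝ) - T p := by
    intro p
    rw [hcol, ← hT, eq_sub_iff_add_eq, ← Finset.sum_add_distrib]
    rw [show (N p : ℝ) = ∑ k, w k * N p by rw [← Finset.sum_mul, hw1, one_mul]]
    apply Finset.sum_congr rfl
    intro k _
    rw [← (hf k).1 p, ← hsplit]; push_cast; ring
  have hTN : ∀ p, T p ≤ N p := by
    intro p
    have : 0 ≤ ∑ x ∈ Aᶜ, G x p := Finset.sum_nonneg (fun x _ => hG x p)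
    rw [hcolB] at this
    exact_mod_cast (sub_nonneg.1 this)
  let c : ι → P → ℝ := fun x p => inner ℝ (pos x) (v p)
  obtain ⟨gA, hgA, hcA⟩ := birk A c G T (fun y _ => hG y) (fun y _ => hrow y) (fun p => by rw [hcol, hT])
  obtain ⟨gB, hgB, hcB⟩ := birk Aᶜ c G (fun p => N p - T p) (fun y _ => hG y) (fun y _ => hrow y) 
    (fun p => by rw [hcolB, Nat.cast_sub (hTN p)])
  let g : ι → P := fun x => if x ∈ A then gA x else gB x
  have hA : ∀ p, (A.filter (fun x => g x = p)).card = T p := by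
    intro p
    rw [← hgA]
    congr 1
    apply Finset.filter_congr
    intro x hx
    simp [g, hx]
  have hB : ∀ p, (Aᶜ.filter (fun x => g x = p)).card = N p - T p := by
    intro p
    rw [← hgB]
    congr 1
    apply Finset.filter_congr
    intro x hx
    have : x ∉ A := by simpa using hx
    simp [g, this]
  have hgF : Feas N g := by
    intro p
    rw [← hsplit, hA, hB]
    have := hTN p
    omega
  have hcost : cost pos v (f k0) ≤ cost pos v g := by
    have e1 : cost pos v g = ∑ x ∈ A, c x (gA x) + ∑ x ∈ Aᶜ, c x (gB x) := by
      unfold cost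
      rw [← Finset.sum_add_sum_compl A]
      congr 1
      · apply Finset.sum_congr rfl
        intro x hx
        simp [g, hx, c]
      · apply Finset.sum_congr rfl
        intro x hx
        have : x ∉ A := by simpa using hx
        simp [g, this, c]
    have e2 : ∑ x, ∑ p, c x p * G x p = cost pos v (f k0) := by
      have : ∑ x, ∑ p, c x p * G x p = ∑ k, w k * cost pos v (f k) := by
        simp only [G, cost, Finset.mul_sum]
        rw [Finset.sum_comm' (t' := univ) (s' := fun _ => univ) (by simp)]
        rw [Finset.sum_comm]
        rw [Finset.sum_comm (γ := κ)]
        apply Finset.sum_congr rfl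
        intro x _
        rw [Finset.sum_comm]
        apply Finset.sum_congr rfl
        intro k _
        simp [c]
        ring
      rw [this]
      have h2 : ∀ k, cost pos v (f k) = cost pos v (f k0) := fun k =>
        le_antisymm ((hf k0).2 _ (hf k).1) ((hf k).2 _ (hf k0).1)
      simp only [h2]
      rw [← Finset.sum_mul, hw1, one_mul]
    rw [e1, ← e2, ← Finset.sum_add_sum_compl A]
    exact add_le_add hcA hcB
  exact ⟨g, ⟨hgF, fun g' hg' => ((hf k0).2 g' hg').trans hcost⟩, hA⟩

end NEP

namespace NEP

abbrev E2 := EuclideanSpace ℝ (Fin 2)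

lemma nocol {X : Finset E2} (hgp : GenPos 2 X) {x p q : E2} (hx : x ∈ X) (hp : p ∈ X) (hq : q ∈ X)
    (h1 : x ≠ p) (h2 : x ≠ q) (h3 : p ≠ q) {u : E2} (hu : u ≠ 0)
    (e1 : inner ℝ p u = inner ℝ x u) (e2 : inner ℝ q u = inner ℝ x u) : False := by
  have hcard : ({x, p, q} : Finset E2).card = 3 := by
    rw [Finset.card_eq_three]; exact ⟨x, p, q, h1, h2, h3, rfl⟩
  have hS : ({x, p, q} : Finset E2) ⊆ X := by
    intro y hy
    simp only [Finset.mem_insert, Finset.mem_singleton] at hy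
    rcases hy with rfl | rfl | rfl <;> assumption
  have hai := hgp {x, p, q} hS (by omega)
  let φ : Fin 3 ↪ ({x, p, q} : Finset E2) :=
    ⟨![⟨x, by simp⟩, ⟨p, by simp⟩, ⟨q, by simp⟩], by
      intro i j
      fin_cases i <;> fin_cases j <;> simp [h1, h2, h3, h1.symm, h2.symm, h3.symm]⟩
  have hai2 := hai.comp_embedding φ
  have : ((fun p : ({x, p, q} : Finset E2) => (p : E2)) ∘ φ) = ![x, p, q] := by
    funext i; fin_cases i <;> rfl
  rw [this, affineIndependent_iff_not_collinear_set] at hai2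
  apply hai2
  rw [collinear_iff_exists_forall_eq_smul_vadd]
  have hu2 : u 0 ^ 2 + u 1 ^ 2 ≠ 0 := by
    intro h
    apply hu
    have a0 : u 0 = 0 := by nlinarith [sq_nonneg (u 0), sq_nonneg (u 1)]
    have a1 : u 1 = 0 := by nlinarith [sq_nonneg (u 0), sq_nonneg (u 1)]
    ext i; fin_cases i
    · exact a0
    · exact a1
  have key : ∀ y : E2, inner ℝ y u = inner ℝ x u → ∃ r : ℝ, y = r • (!₂[-(u 1), u 0] : E2) +ᵥ x := by
    intro y hy
    simp only [PiLp.inner_apply, Fin.sum_univ_two, RCLike.inner_apply, conj_trivial] at hy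
    refine ⟨(-(u 1) * (y 0 - x 0) + u 0 * (y 1 - x 1)) / (u 0 ^ 2 + u 1 ^ 2), ?_⟩
    ext i; fin_cases i
    · simp
      field_simp
      linear_combination (u 0) * hy
    · simp
      field_simp
      linear_combination (u 1) * hy
  refine ⟨x, !₂[-(u 1), u 0], ?_⟩
  intro y hy
  simp only [Set.mem_insert_iff, Set.mem_singleton_iff] at hy
  rcases hy with rfl | rfl | rfl
  · exact key _ rfl
  · exact key _ e1
  · exact key _ e2

lemma face {P : Finset E2} {u z : E2} {c : ℝ} (hz : z ∈ convexHull ℝ (P : Set E2))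
    (hP : ∀ x ∈ P, c ≤ inner ℝ x u) (hc : inner ℝ z u = c) :
    (∃ p ∈ P, inner ℝ p u = c) ∧ ∀ p, (∀ x ∈ P, inner ℝ x u = c → x = p) → z = p := by
  rw [Finset.mem_convexHull'] at hz
  obtain ⟨w, hw, hw1, hwz⟩ := hz
  have h0 : ∑ y ∈ P, w y * (inner ℝ y u - c) = 0 := by
    simp only [mul_sub, Finset.sum_sub_distrib]
    rw [← Finset.sum_mul, hw1, ← hc, ← hwz, sum_inner]
    simp [inner_smul_left]
  have h1 := (Finset.sum_eq_zero_iff_of_nonneg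
    (fun y hy => mul_nonneg (hw y hy) (sub_nonneg.2 (hP y hy)))).1 h0
  have h2 : ∀ y ∈ P, w y ≠ 0 → inner ℝ y u = c := by
    intro y hy hwy
    rcases mul_eq_zero.1 (h1 y hy) with h | h
    · exact absurd h hwy
    · linarith
  constructor
  · obtain ⟨y, hy, hwy⟩ := Finset.exists_ne_zero_of_sum_ne_zero (s := P) (f := w) (by rw [hw1]; norm_num)
    exact ⟨y, hy, h2 y hy hwy⟩
  · intro p hp
    rw [← hwz]
    have : ∀ y ∈ P, w y • y = w y • p := by
      intro y hy
      by_cases h : w y = 0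
      · simp [h]
      · rw [hp y hy (h2 y hy h)]
    rw [Finset.sum_congr rfl this, ← Finset.sum_smul, hw1, one_smul]

lemma sep {X P Q : Finset E2} (hgp : GenPos 2 X) (hP : P ⊆ X) (hQ : Q ⊆ X) (hPQ : Disjoint P Q)
    {u : E2} (hu : u ≠ 0) (h : ∀ x ∈ P, ∀ y ∈ Q, inner ℝ y u ≤ inner ℝ x u) :
    Disjoint (convexHull ℝ (P : Set E2)) (convexHull ℝ (Q : Set E2)) := by
  rw [Set.disjoint_left]
  intro z hzP hzQ
  -- z is between
  have hb : ∀ x ∈ P, inner ℝ z u ≤ inner ℝ x u := by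
    intro x hx
    have : convexHull ℝ (Q : Set E2) ⊆ {y | inner ℝ y u ≤ inner ℝ x u} := by
      apply convexHull_min (fun y hy => h x hx y hy)
      intro c hc d hd r t hr ht hrt
      have hc' : inner ℝ c u ≤ inner ℝ x u := hc
      have hd' : inner ℝ d u ≤ inner ℝ x u := hd
      show inner ℝ (r • c + t • d) u ≤ inner ℝ x u
      rw [inner_add_left, inner_smul_left, inner_smul_left]
      simp only [conj_trivial]
      have e1 := mul_le_mul_of_nonneg_left hc' hr
      have e2 := mul_le_mul_of_nonneg_left hd' ht
      have e3 : inner ℝ x u = r * inner ℝ x u + t * inner ℝ x u := by rw [← add_mul, hrt, one_mul]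
      linarith
    exact this hzQ
  have hb2 : ∀ y ∈ Q, inner ℝ y u ≤ inner ℝ z u := by
    intro y hy
    have : convexHull ℝ (P : Set E2) ⊆ {x | inner ℝ y u ≤ inner ℝ x u} := by
      apply convexHull_min (fun x hx => h x hx y hy)
      intro c hc d hd r t hr ht hrt
      have hc' : inner ℝ y u ≤ inner ℝ c u := hc
      have hd' : inner ℝ y u ≤ inner ℝ d u := hd
      show inner ℝ y u ≤ inner ℝ (r • c + t • d) u
      rw [inner_add_left, inner_smul_left, inner_smul_left]
      simp only [conj_trivial]
      have e1 := mul_le_mul_of_nonneg_left hc' hr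
      have e2 := mul_le_mul_of_nonneg_left hd' ht
      have e3 : inner ℝ y u = r * inner ℝ y u + t * inner ℝ y u := by rw [← add_mul, hrt, one_mul]
      linarith
    exact this hzP
  obtain ⟨⟨p, hp, hpe⟩, hp2⟩ := face hzP hb rfl
  obtain ⟨⟨q, hq, hqe⟩, hq2⟩ := face (u := -u) (c := - inner ℝ z u) hzQ
    (by intro y hy; rw [inner_neg_right]; linarith [hb2 y hy]) (by rw [inner_neg_right])
  rw [inner_neg_right, neg_inj] at hqe
  have hne : ∀ x ∈ P, ∀ y ∈ Q, x ≠ y := fun x hx y hy hxy => 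
    (Finset.disjoint_left.1 hPQ hx) (hxy ▸ hy)
  have e1 : z = p := by
    apply hp2
    intro x hx hxe
    by_contra hxp
    exact nocol hgp (hP hx) (hP hp) (hQ hq) hxp (hne x hx q hq) (hne p hp q hq) hu
      (by rw [hpe, hxe]) (by rw [hqe, hxe])
  have e2 : z = q := by
    apply hq2
    intro x hx hxe
    rw [inner_neg_right, neg_inj] at hxe
    by_contra hxp
    exact nocol hgp (hQ hx) (hP hp) (hQ hq) (hne p hp x hx).symm hxp (hne p hp q hq) hu
      (by rw [hpe, hxe]) (by rw [hqe, hxe])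
  exact hne p hp q hq (e1.symm.trans e2)

/-- `H` is the part of `X` in a (weak) half plane with inner normal `u` -/
def IsHalf (X : Finset E2) (u : E2) (H : Finset E2) : Prop :=
  H ⊆ X ∧ ∀ x ∈ H, ∀ y ∈ X, y ∉ H → inner ℝ y u ≤ inner ℝ x u

def part {X : Finset E2} {P : Type*} [DecidableEq P] (f : X → P) (p : P) : Finset E2 :=
  (Finset.univ.filter (fun x : X => f x = p)).map (Function.Embedding.subtype _)

section
variable {X : Finset E2} {P : Type*} [DecidableEq P] (f : X → P)

lemma mem_part (p : P) (x : E2) : x ∈ part f p ↔ ∃ h : x ∈ X, f ⟨x, h⟩ = p := by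
  simp [part]

lemma part_subset (p : P) : part f p ⊆ X := by
  intro x hx
  exact ((mem_part f p x).1 hx).1

lemma part_disjoint {p q : P} (h : p ≠ q) : Disjoint (part f p) (part f q) := by
  rw [Finset.disjoint_left]
  intro x hx hy
  obtain ⟨h1, h2⟩ := (mem_part f p x).1 hx
  obtain ⟨h3, h4⟩ := (mem_part f q x).1 hy
  exact h (h2.symm.trans h4)

lemma card_part {N : P → ℕ} (hf : Feas N f) (p : P) : (part f p).card = N p := by
  rw [part, Finset.card_map, hf p]

noncomputable def AA (X A : Finset E2) : Finset X := Finset.univ.filter (fun x : X => (x : E2) ∈ A)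

lemma card_part_inter (A : Finset E2) (p : P) : 
    (part f p ∩ A).card = ((AA X A).filter (fun x => f x = p)).card := by
  have : part f p ∩ A = ((AA X A).filter (fun x => f x = p)).map (Function.Embedding.subtype _) := by
    ext x
    simp only [Finset.mem_inter, mem_part, Finset.mem_map, Finset.mem_filter, AA, Finset.mem_univ, true_and,
      Function.Embedding.subtype_apply, Subtype.exists, exists_and_right, exists_eq_right]
    tauto
  rw [this, Finset.card_map]

lemma card_AA (A : Finset E2) : (AA X A).card = (X ∩ A).card := by
  have : X ∩ A = (AA X A).map (Function.Embedding.subtype _) := by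
    ext x
    simp only [Finset.mem_inter, Finset.mem_map, Finset.mem_filter, AA, Finset.mem_univ, true_and,
      Function.Embedding.subtype_apply, Subtype.exists, exists_and_right, exists_eq_right]
    tauto
  rw [this, Finset.card_map]

lemma sum_part_inter [Fintype P] (A : Finset E2) : ∑ p, (part f p ∩ A).card = (X ∩ A).card := by
  simp only [card_part_inter]
  rw [← card_AA, ← Finset.card_eq_sum_card_fiberwise (f := f) (t := Finset.univ)]
  simp

lemma half_of_opt [Fintype P] {N : P → ℕ} {v : P → E2} 
    {f : X → P} (hf : Opt (fun x : X => (x : E2)) N v f) (p : P) (u : E2)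
    (h : ∀ q, q ≠ p → ∃ r : ℝ, 0 < r ∧ v p - v q = r • u) : IsHalf X u (part f p) := by
  refine ⟨part_subset f p, fun x hx y hy hyp => ?_⟩
  obtain ⟨hxX, hxp⟩ := (mem_part f p x).1 hx
  have hq : f ⟨y, hy⟩ ≠ p := fun hh => hyp ((mem_part f p y).2 ⟨hy, hh⟩)
  obtain ⟨r, hr, hv⟩ := h _ hq
  have := hf.swap ⟨x, hxX⟩ ⟨y, hy⟩
  rw [hxp, hv, inner_smul_right, inner_smul_right] at this
  exact le_of_mul_le_mul_left this hr

end

lemma exists_half (X : Finset E2) (u : E2) (M : ℕ) (hM : M ≤ X.card) : 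
    ∃ H, IsHalf X u H ∧ H.card = M := by
  obtain ⟨f, hf⟩ := exists_opt (fun x : X => (x : E2)) ![M, X.card - M] ![u, 0] 
    (by simp [Fin.sum_univ_two, hM])
  refine ⟨part f 0, half_of_opt hf 0 u ?_, ?_⟩
  · intro q hq
    refine ⟨1, one_pos, ?_⟩
    fin_cases q
    · exact absurd rfl hq
    · simp
  · rw [card_part f hf.1]; rfl

lemma half_compl {X H : Finset E2} {u : E2} (h : IsHalf X u H) : IsHalf X (-u) (X \ H) := by
  refine ⟨Finset.sdiff_subset, fun x hx y hy hyn => ?_⟩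
  simp only [Finset.mem_sdiff, not_and, not_not] at hx hyn
  rw [inner_neg_right, inner_neg_right]
  linarith [h.2 y (hyn hy) x hx.1 hx.2]

lemma half_sep {X H : Finset E2} {u : E2} (hgp : GenPos 2 X) (hu : u ≠ 0) (h : IsHalf X u H) :
    Disjoint (convexHull ℝ (H : Set E2)) (convexHull ℝ ((X \ H : Finset E2) : Set E2)) := by
  apply sep hgp h.1 Finset.sdiff_subset Finset.disjoint_sdiff hu
  intro x hx y hy
  rw [Finset.mem_sdiff] at hy
  exact h.2 x hx y hy.1 hy.2

/-- two half planes of the same size and direction differ in at most one point -/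
lemma half_close {X H K A : Finset E2} {u : E2} (hgp : GenPos 2 X) (hu : u ≠ 0) (hH : IsHalf X u H)
    (hK : IsHalf X u K) (hc : H.card = K.card) : (K ∩ A).card ≤ (H ∩ A).card + 1 := by
  have hcc : (H \ K).card = (K \ H).card := by
    have := Finset.card_sdiff_add_card_inter H K
    have h2 := Finset.card_sdiff_add_card_inter K H
    rw [Finset.inter_comm] at h2
    omega
  have h1 : (K \ H).card ≤ 1 := by
    by_contra hlt
    push Not at hlt
    obtain ⟨y, hy, y', hy', hne⟩ := Finset.one_lt_card.1 hlt
    obtain ⟨x, hx⟩ := Finset.card_pos.1 (by omega : 0 < (H \ K).card)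
    rw [Finset.mem_sdiff] at hx hy hy'
    have a1 := hH.2 x hx.1 y (hK.1 hy.1) hy.2
    have a2 := hK.2 y hy.1 x (hH.1 hx.1) hx.2
    have a3 := hH.2 x hx.1 y' (hK.1 hy'.1) hy'.2
    have a4 := hK.2 y' hy'.1 x (hH.1 hx.1) hx.2
    exact nocol hgp (hH.1 hx.1) (hK.1 hy.1) (hK.1 hy'.1) (fun h => hx.2 (h ▸ hy.1))
      (fun h => hx.2 (h ▸ hy'.1)) hne hu (le_antisymm a1 a2) (le_antisymm a3 a4)
  have : K ∩ A ⊆ (H ∩ A) ∪ (K \ H) := by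
    intro z hz
    simp only [Finset.mem_inter, Finset.mem_union, Finset.mem_sdiff] at hz ⊢
    tauto
  have := (Finset.card_le_card this).trans (Finset.card_union_le _ _)
  omega

set_option maxHeartbeats 1000000 in
/-- discrete intermediate value theorem for half planes -/
lemma half_ivt {X A : Finset E2} (hgp : GenPos 2 X) (M : ℕ) (hM : M ≤ X.card) (lo hi : ℤ) (hlh : lo ≤ hi)
    (hno : ∀ u : E2, u ≠ 0 → ∀ H, IsHalf X u H → H.card = M → 
      ((H ∩ A).card : ℤ) < lo ∨ hi < ((H ∩ A).card : ℤ)) :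
    (∀ u : E2, u ≠ 0 → ∀ H, IsHalf X u H → H.card = M → ((H ∩ A).card : ℤ) < lo) ∨
    (∀ u : E2, u ≠ 0 → ∀ H, IsHalf X u H → H.card = M → hi < ((H ∩ A).card : ℤ)) := by
  by_contra hcon
  push Not at hcon
  obtain ⟨⟨u1, hu1, H1, hH1, hc1, hn1⟩, ⟨u2, hu2, H2, hH2, hc2, hn2⟩⟩ := hcon
  have hcl : ∀ H : Finset E2, IsClosed {u : E2 | IsHalf X u H} := by
    intro H
    unfold IsHalf
    by_cases h : H ⊆ X
    · simp only [h, true_and, Set.ofPred_forall]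
      refine isClosed_iInter fun x => isClosed_iInter fun _ => isClosed_iInter fun y => 
        isClosed_iInter fun _ => isClosed_iInter fun _ => isClosed_le (by fun_prop) (by fun_prop)
    · simp [h]
  have hW : ∀ Q : ℤ → Prop, IsClosed {u : E2 | ∃ H, IsHalf X u H ∧ H.card = M ∧ Q ((H ∩ A).card : ℤ)} := by
    intro Q
    have : {u : E2 | ∃ H, IsHalf X u H ∧ H.card = M ∧ Q ((H ∩ A).card : ℤ)} =
        ⋃ H ∈ {H : Finset E2 | H ∈ X.powerset ∧ H.card = M ∧ Q ((H ∩ A).card : ℤ)},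
          {u : E2 | IsHalf X u H} := by
      ext u
      simp only [Set.mem_iUnion, Set.mem_ofPred_eq, exists_prop, Finset.mem_powerset]
      constructor
      · rintro ⟨H, h4, h2, h3⟩; exact ⟨H, ⟨h4.1, h2, h3⟩, h4⟩
      · rintro ⟨H, ⟨h1, h2, h3⟩, h4⟩; exact ⟨H, h4, h2, h3⟩
    rw [this]
    apply Set.Finite.isClosed_biUnion
    · exact (X.powerset.finite_toSet).subset (fun H hH => hH.1)
    · intro H _; exact hcl H
  have hpre : IsPreconnected (({0} : Set E2)ᶜ) := by
    apply (isConnected_compl_singleton_of_one_lt_rank _ 0).isPreconnected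
    rw [← Module.finrank_eq_rank]
    simp
  have c1 := hW (fun c => c < lo)
  have c2 := hW (fun c => hi < c)
  obtain ⟨u, hu, ⟨K1, hK1, hk1, hq1⟩, ⟨K2, hK2, hk2, hq2⟩⟩ :=
    isPreconnected_closed_iff.1 hpre _ _ c1 c2
    (by
      intro u hu
      obtain ⟨H, hH, hc⟩ := exists_half X u M hM
      rcases hno u (by simpa using hu) H hH hc with h | h
      · left; exact ⟨H, hH, hc, h⟩
      · right; exact ⟨H, hH, hc, h⟩)
    ⟨u2, by simpa using hu2, ⟨H2, hH2, hc2, (hno u2 hu2 H2 hH2 hc2).resolve_right (by omega)⟩⟩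
    ⟨u1, by simpa using hu1, ⟨H1, hH1, hc1, (hno u1 hu1 H1 hH1 hc1).resolve_left (by omega)⟩⟩
  have := half_close (A := A) hgp (by simpa using hu) hK1 hK2 (hk1.trans hk2.symm)
  omega

end NEP

namespace NEP

noncomputable def tau (z : ℝ × ℝ) : ℝ := min (1 - |z.1|) (1 - z.2)

noncomputable def VV (z : ℝ × ℝ) : Fin 3 → E2 := ![!₂[-tau z, 0], !₂[tau z, 0], !₂[z.1, z.2]]

lemma continuous_tau : Continuous tau := by
  unfold tau
  fun_prop

lemma continuous_VV : Continuous VV := by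
  have := continuous_tau
  rw [continuous_pi_iff]
  intro i
  fin_cases i
  · simp only [VV]
    refine (PiLp.continuous_toLp 2 _).comp ?_
    rw [continuous_pi_iff]
    intro j
    fin_cases j
    · exact this.neg
    · simpa using continuous_const
  · simp only [VV]
    refine (PiLp.continuous_toLp 2 _).comp ?_
    rw [continuous_pi_iff]
    intro j
    fin_cases j
    · simpa using this
    · simpa using continuous_const
  · simp only [VV]
    refine (PiLp.continuous_toLp 2 _).comp ?_
    rw [continuous_pi_iff]
    intro j
    fin_cases j
    · simpa using continuous_fst
    · simpa using continuous_snd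

lemma three_cut {X A : Finset E2} (N T : Fin 3 → ℕ) (ε : ℝ) (hε : ε ≠ 0)
    (hN : ∑ p, N p = X.card) (hT : ∑ p, T p = (X ∩ A).card)
    (hyp : ∀ p, ∀ u : E2, u ≠ 0 → ∀ H, IsHalf X u H → H.card = N p →
      ε * (((H ∩ A).card : ℝ) - T p) < 0) :
    ∃ (v : Fin 3 → E2) (f : X → Fin 3), Function.Injective v ∧
      Opt (fun x : X => (x : E2)) N v f ∧ ∀ p, (part f p ∩ A).card = T p := by
  let d : (X → Fin 3) → Fin 3 → ℝ := fun f p => ε * (((part f p ∩ A).card : ℝ) - T p)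
  have hd : ∀ f, d f 2 = - (d f 0 + d f 1) := by
    intro f
    have h1 := sum_part_inter f A
    rw [← hT, Fin.sum_univ_three, Fin.sum_univ_three] at h1
    have h2 : (((part f 0 ∩ A).card : ℝ)) + (part f 1 ∩ A).card + (part f 2 ∩ A).card
      = T 0 + T 1 + T 2 := by exact_mod_cast h1
    simp only [d]
    linear_combination ε * h2
  have hpart : ∀ z f p u, u ≠ 0 → Opt (fun x : X => (x : E2)) N (VV z) f →
      (∀ q, q ≠ p → ∃ r : ℝ, 0 < r ∧ VV z p - VV z q = r • u) → d f p < 0 := by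
    intro z f p u hu hf h
    exact hyp p u hu _ (half_of_opt hf p u h) (card_part f hf.1 p)
  have he1 : (!₂[1, 0] : E2) ≠ 0 := by
    intro h
    have := congrArg (fun w : E2 => w 0) h
    simp at this
  have hcard : ∑ p, N p = Fintype.card X := by simpa using hN
  obtain ⟨z, hz, f, g, h, hzf, hzg, hzh, a, b, c, ha, hb, hc, habc, e0, e1⟩ :=
    topo (Φ := X → Fin 3) (fun f => (d f 0, d f 1))
      (fun f => {z | Opt (fun x : X => (x : E2)) N (VV z) f})
      (fun f => (isClosed_opt (fun x : X => (x : E2)) N f).preimage continuous_VV)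
      (fun z _ => exists_opt _ N (VV z) hcard)
      (by
        intro f z hf hz hbd
        have ht : tau z = 0 := by
          obtain ⟨⟨h1, h2⟩, h3, h4⟩ := hz
          have : |z.1| ≤ 1 := abs_le.2 ⟨h1, h2⟩
          unfold tau
          rcases hbd with h | h | h
          · rw [h]; simp; linarith
          · rw [h]; simp; linarith
          · rw [h]; simp; linarith
        have := hpart z f 2 (VV z 2) (by
          intro h
          have h1 := congrArg (fun w : E2 => w 0) h
          have h2 := congrArg (fun w : E2 => w 1) h
          simp [VV] at h1 h2
          rw [h1, h2] at hbd
          norm_num at hbd) hf (by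
            intro q hq
            refine ⟨1, one_pos, ?_⟩
            fin_cases q
            · ext i; fin_cases i <;> simp [VV, ht]
            · ext i; fin_cases i <;> simp [VV, ht]
            · exact absurd rfl hq)
        have h2 := hd f
        simp only
        linarith)
      (by
        intro f z hf hz h1 h2
        have ht : tau z = 1 + z.1 := by
          unfold tau
          rw [abs_of_nonpos h2, hz, min_eq_left (by linarith)]; ring
        refine hpart z f 1 _ he1 hf ?_
        intro q hq
        fin_cases q
        · refine ⟨2 * tau z, by linarith, ?_⟩
          ext i; fin_cases i <;> simp [VV]; ring
        · exact absurd rfl hq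
        · refine ⟨tau z - z.1, by linarith, ?_⟩
          ext i; fin_cases i <;> simp [VV, hz])
      (by
        intro f z hf hz h1 h2
        have ht : tau z = 1 - z.1 := by
          unfold tau
          rw [abs_of_nonneg h1, hz, min_eq_left (by linarith)]
        refine hpart z f 0 _ (neg_ne_zero.2 he1) hf ?_
        intro q hq
        fin_cases q
        · exact absurd rfl hq
        · refine ⟨2 * tau z, by linarith, ?_⟩
          ext i; fin_cases i <;> simp [VV]; ring
        · refine ⟨tau z + z.1, by linarith, ?_⟩
          ext i; fin_cases i <;> simp [VV, hz]; ring)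
      (by
        intro f z hf hz h1 h2
        have ht : tau z = 1 + z.1 := by
          unfold tau
          rw [abs_of_nonpos (by linarith), hz, min_eq_left (by linarith)]; ring
        have := hpart z f 2 _ (neg_ne_zero.2 he1) hf (by
          intro q hq
          fin_cases q
          · refine ⟨-tau z - z.1, by linarith, ?_⟩
            ext i; fin_cases i <;> simp [VV, hz]
          · refine ⟨tau z - z.1, by linarith, ?_⟩
            ext i; fin_cases i <;> simp [VV, hz]
          · exact absurd rfl hq)
        have h2 := hd f
        simp only
        linarith)
      (by
        intro f z hf hz h1 h2
        have ht : tau z = 1 - z.1 := by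
          unfold tau
          rw [abs_of_nonneg (by linarith), hz, min_eq_left (by linarith)]
        have := hpart z f 2 _ he1 hf (by
          intro q hq
          fin_cases q
          · refine ⟨z.1 + tau z, by linarith, ?_⟩
            ext i; fin_cases i <;> simp [VV, hz]
          · refine ⟨z.1 - tau z, by linarith, ?_⟩
            ext i; fin_cases i <;> simp [VV, hz]
          · exact absurd rfl hq)
        have h2 := hd f
        simp only
        linarith)
  simp only at e0 e1
  have e2 : a * d f 2 + b * d g 2 + c * d h 2 = 0 := by
    rw [hd, hd, hd]; linear_combination - e0 - e1
  have eall : ∀ p, a * d f p + b * d g p + c * d h p = 0 := by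
    intro p; fin_cases p
    · exact e0
    · exact e1
    · exact e2
  obtain ⟨G, hG, hGT⟩ := round (κ := Fin 3) (pos := fun x : X => (x : E2)) (N := N) (v := VV z)
    ![f, g, h] (by intro k; fin_cases k <;> assumption) ![a, b, c]
    (by intro k; fin_cases k <;> assumption) (by simpa [Fin.sum_univ_three] using habc) (AA X A) T (by
      intro p
      have h1 := eall p
      simp only [d, card_part_inter] at h1
      rw [Fin.sum_univ_three]
      change a * (((AA X A).filter (fun x => f x = p)).card : ℝ)
        + b * (((AA X A).filter (fun x => g x = p)).card : ℝ)
        + c * (((AA X A).filter (fun x => h x = p)).card : ℝ) = T p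
      apply mul_left_cancel₀ hε
      linear_combination h1 + ε * (T p) * habc)
  have hGT' : ∀ p, (part G p ∩ A).card = T p := fun p => by rw [card_part_inter]; exact hGT p
  refine ⟨VV z, G, ?_, hG, hGT'⟩
  have key : ∀ p q r : Fin 3, (∀ s, s = p ∨ s = q ∨ s = r) → VV z q = VV z r → VV z p = VV z q := by
    intro p q r hs hqr
    by_contra hne
    have := hpart z G p (VV z p - VV z q) (sub_ne_zero.2 hne) hG (by
      intro s hsp
      refine ⟨1, one_pos, ?_⟩
      rcases hs s with rfl | rfl | rfl
      · exact absurd rfl hsp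
      · simp
      · simp [hqr])
    simp [d, hGT'] at this
  have bad : VV z 0 = VV z 1 → VV z 2 = VV z 0 → False := by
    intro h1 h2
    have h3 := congrArg (fun w : E2 => w 0) h1
    have h4 := congrArg (fun w : E2 => w 0) h2
    have h5 := congrArg (fun w : E2 => w 1) h2
    simp [VV] at h3 h4 h5
    have h6 : tau z = 0 := by linarith
    rw [h6] at h4
    unfold tau at h6
    rw [h4, h5] at h6
    norm_num at h6
  have a01 : VV z 0 ≠ VV z 1 := fun hh => bad hh (key 2 0 1 (by decide) hh)
  have a02 : VV z 0 ≠ VV z 2 := fun hh => bad (key 1 0 2 (by decide) hh).symm hh.symm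
  have a12 : VV z 1 ≠ VV z 2 := fun hh =>
    bad (key 0 1 2 (by decide) hh) (by rw [key 0 1 2 (by decide) hh, hh])
  intro i j hij
  fin_cases i <;> fin_cases j <;> first
    | rfl
    | exact absurd hij a01
    | exact absurd hij a02
    | exact absurd hij a12
    | exact absurd hij a01.symm
    | exact absurd hij a02.symm
    | exact absurd hij a12.symm

end NEP

namespace NEP

def Neg (X A : Finset E2) (k a s n m : ℕ) : Prop :=
  ∀ u : E2, u ≠ 0 → ∀ H, IsHalf X u H → H.card = m * k →
    ((H ∩ A).card : ℤ) < (m * a : ℕ) + max 0 ((s : ℤ) - n + m)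

def Pos (X A : Finset E2) (k a s m : ℕ) : Prop :=
  ∀ u : E2, u ≠ 0 → ∀ H, IsHalf X u H → H.card = m * k →
    ((m * a : ℕ) + min (m : ℤ) s) < ((H ∩ A).card : ℤ)

def LineSplit (X A : Finset E2) (k a s n : ℕ) : Prop :=
  ∃ m e : ℕ, 1 ≤ m ∧ m < n ∧ e ≤ m ∧ e ≤ s ∧ s + m ≤ n + e ∧ ∃ u : E2, u ≠ 0 ∧ ∃ H, IsHalf X u H ∧
    H.card = m * k ∧ (H ∩ A).card = m * a + e

def TriSplit (X A : Finset E2) (k a s n : ℕ) : Prop :=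
  ∃ m T : Fin 3 → ℕ, (∀ p, 1 ≤ m p) ∧ m 0 + m 1 + m 2 = n ∧ (∀ p, T p ≤ m p) ∧ T 0 + T 1 + T 2 = s ∧
    ∃ (v : Fin 3 → E2) (f : X → Fin 3), Function.Injective v ∧
      Opt (fun x : X => (x : E2)) (fun p => m p * k) v f ∧
        ∀ p, (part f p ∩ A).card = m p * a + T p

lemma e1_ne : (!₂[1, 0] : E2) ≠ 0 := by
  intro h
  have := congrArg (fun w : E2 => w 0) h
  simp at this

lemma neg_or_pos {X A : Finset E2} (hgp : GenPos 2 X) {k a s n : ℕ} (hs : s ≤ n) (hX : X.card = n * k)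
    (hno : ¬ LineSplit X A k a s n) (m : ℕ) (hm : 1 ≤ m) (hmn : m < n) :
    Neg X A k a s n m ∨ Pos X A k a s m := by
  refine half_ivt hgp (m * k) (by rw [hX]; exact Nat.mul_le_mul_right k hmn.le)
    ((m * a : ℕ) + max 0 ((s : ℤ) - n + m)) ((m * a : ℕ) + min (m : ℤ) s) (by omega) ?_
  intro u hu H hH hc
  by_contra hcon
  apply hno
  generalize hma : m * a = ma at hcon
  refine ⟨m, (H ∩ A).card - ma, hm, hmn, by omega, by omega, by omega, u, hu, H, hH, hc, ?_⟩
  rw [hma]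
  omega

lemma compl_half {X A H : Finset E2} {k a s n m : ℕ} {u : E2} (hX : X.card = n * k)
    (hXA : (X ∩ A).card = n * a + s) (hmn : m < n) (hH : IsHalf X u H) (hc : H.card = m * k) :
    IsHalf X (-u) (X \ H) ∧ (X \ H).card = (n - m) * k ∧
      ((X \ H) ∩ A).card + (H ∩ A).card = (n - m) * a + m * a + s := by
  refine ⟨half_compl hH, ?_, ?_⟩
  · rw [Finset.card_sdiff_of_subset hH.1, hX, hc, Nat.sub_mul]
  · have h1 : (n - m) * a + m * a = n * a := by rw [← Nat.add_mul, Nat.sub_add_cancel hmn.le]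
    rw [h1, ← hXA, ← Finset.card_union_of_disjoint]
    · congr 1
      rw [← Finset.union_inter_distrib_right, Finset.sdiff_union_of_subset hH.1]
    · exact Finset.disjoint_of_subset_left Finset.inter_subset_left
        (Finset.disjoint_of_subset_right Finset.inter_subset_left Finset.sdiff_disjoint)

lemma neg_not_neg {X A : Finset E2} {k a s n : ℕ} (hs : s ≤ n) (hX : X.card = n * k)
    (hXA : (X ∩ A).card = n * a + s) (m : ℕ) (hmn : m < n)
    (h1 : Neg X A k a s n m) (h2 : Neg X A k a s n (n - m)) : False := by
  obtain ⟨H, hH, hc⟩ := exists_half X !₂[1, 0] (m * k) (by rw [hX]; exact Nat.mul_le_mul_right k hmn.le)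
  obtain ⟨h3, h4, h5⟩ := compl_half hX hXA hmn hH hc
  have h6 := h1 _ e1_ne H hH hc
  have h7 := h2 _ (neg_ne_zero.2 e1_ne) _ h3 h4
  generalize m * a = x at *
  generalize (n - m) * a = y at *
  omega

lemma pos_not_pos {X A : Finset E2} {k a s n : ℕ} (hs : s ≤ n) (hX : X.card = n * k)
    (hXA : (X ∩ A).card = n * a + s) (m : ℕ) (hmn : m < n)
    (h1 : Pos X A k a s m) (h2 : Pos X A k a s (n - m)) : False := by
  obtain ⟨H, hH, hc⟩ := exists_half X !₂[1, 0] (m * k) (by rw [hX]; exact Nat.mul_le_mul_right k hmn.le)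
  obtain ⟨h3, h4, h5⟩ := compl_half hX hXA hmn hH hc
  have h6 := h1 _ e1_ne H hH hc
  have h7 := h2 _ (neg_ne_zero.2 e1_ne) _ h3 h4
  generalize m * a = x at *
  generalize (n - m) * a = y at *
  omega

lemma greedy (s n : ℕ) (hs : s ≤ n) (m : Fin 3 → ℕ) (hm : m 0 + m 1 + m 2 = n) :
    ∃ T : Fin 3 → ℕ, (∀ p, T p ≤ m p) ∧ T 0 + T 1 + T 2 = s ∧ ∀ p, s + m p ≤ n + T p := by
  refine ⟨![min s (m 0), min (s - min s (m 0)) (m 1), s - min s (m 0) - min (s - min s (m 0)) (m 1)],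
    ?_, ?_, ?_⟩
  · intro p
    fin_cases p <;> simp <;> omega
  · simp
  · intro p
    fin_cases p <;> simp <;> omega

lemma tri_of_sign {X A : Finset E2} {k a s n : ℕ} (hs : s ≤ n) (hX : X.card = n * k)
    (hXA : (X ∩ A).card = n * a + s) (m : Fin 3 → ℕ) (hm1 : ∀ p, 1 ≤ m p) (hm : m 0 + m 1 + m 2 = n)
    (h : (∀ p, Neg X A k a s n (m p)) ∨ ∀ p, Pos X A k a s (m p)) : TriSplit X A k a s n := by
  obtain ⟨T, hT1, hT2, hT3⟩ := greedy s n hs m hm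
  refine ⟨m, T, hm1, hm, hT1, hT2, ?_⟩
  have hN : ∑ p, m p * k = X.card := by
    rw [hX, ← hm, Fin.sum_univ_three]; ring
  have hT : ∑ p, (m p * a + T p) = (X ∩ A).card := by
    rw [hXA, ← hm, ← hT2, Fin.sum_univ_three]; ring
  have hTs : ∀ p, T p ≤ s := by
    intro p
    fin_cases p <;> simp <;> omega
  rcases h with h | h
  · refine three_cut (fun p => m p * k) (fun p => m p * a + T p) 1 one_ne_zero hN hT ?_
    intro p u hu H hH hc
    have h1 := h p u hu H hH hc
    have h2 := hT3 p
    have h3 : (H ∩ A).card < m p * a + T p := by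
      generalize m p * a = x at *
      omega
    have h4 : ((H ∩ A).card : ℝ) < ((m p * a + T p : ℕ) : ℝ) := by exact_mod_cast h3
    linarith
  · refine three_cut (fun p => m p * k) (fun p => m p * a + T p) (-1) (by norm_num) hN hT ?_
    intro p u hu H hH hc
    have h1 := h p u hu H hH hc
    have h2 := hT1 p
    have h5 := hTs p
    have h3 : m p * a + T p < (H ∩ A).card := by
      generalize m p * a = x at *
      omega
    have h4 : ((m p * a + T p : ℕ) : ℝ) < ((H ∩ A).card : ℝ) := by exact_mod_cast h3
    linarith

lemma step {X A : Finset E2} (hgp : GenPos 2 X) {k a s n : ℕ} (hn : 2 ≤ n) (hs : s ≤ n)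
    (hX : X.card = n * k) (hXA : (X ∩ A).card = n * a + s) :
    LineSplit X A k a s n ∨ TriSplit X A k a s n := by
  by_cases hL : LineSplit X A k a s n
  · exact Or.inl hL
  right
  have hnp := neg_or_pos hgp hs hX hL
  have hnn := neg_not_neg (k := k) (a := a) hs hX hXA
  have hpp := pos_not_pos (k := k) (a := a) hs hX hXA
  have hex : ∃ i, 1 ≤ i ∧ i + 1 < n ∧ (Neg X A k a s n i ↔ Neg X A k a s n 1) ∧
      ¬ (Neg X A k a s n (i + 1) ↔ Neg X A k a s n 1) := by
    by_contra hcon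
    push Not at hcon
    have hall : ∀ i, 1 ≤ i → i < n → (Neg X A k a s n i ↔ Neg X A k a s n 1) := by
      intro i hi
      induction i, hi using Nat.le_induction with
      | base => intro _; rfl
      | succ i hi ih =>
        intro h
        have h1 := ih (by omega)
        exact hcon i hi h h1
    have h1 := hall (n - 1) (by omega) (by omega)
    have h2 := hnn 1 (by omega)
    have h3 := hpp 1 (by omega)
    have h4 := hnp 1 (by omega) (by omega)
    have h5 := hnp (n - 1) (by omega) (by omega)
    by_cases hN : Neg X A k a s n 1
    · exact h2 hN (h1.2 hN)
    · exact h3 (h4.resolve_left hN) (h5.resolve_left (fun h => hN (h1.1 h)))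
  obtain ⟨i, hi1, hin, e1, e2⟩ := hex
  have c1 := hnp 1 (by omega) (by omega)
  have c2 := hnp i (by omega) (by omega)
  have c3 := hnp (i + 1) (by omega) (by omega)
  have c4 := hnp (n - (i + 1)) (by omega) (by omega)
  have d1 := hnn (i + 1) (by omega)
  have d2 := hpp (i + 1) (by omega)
  refine tri_of_sign hs hX hXA ![i, 1, n - (i + 1)] ?_ (by simp; omega) ?_
  · intro p
    fin_cases p <;> simp <;> omega
  · by_cases hN : Neg X A k a s n 1
    · left
      have f1 : Neg X A k a s n i := e1.2 hN
      have g : Pos X A k a s (i + 1) := c3.resolve_left (fun h => e2 ⟨fun _ => hN, fun _ => h⟩)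
      have f2 : Neg X A k a s n (n - (i + 1)) := c4.resolve_right (d2 g)
      intro p
      fin_cases p
      · exact f1
      · exact hN
      · exact f2
    · right
      have f0 : Pos X A k a s 1 := c1.resolve_left hN
      have f1 : Pos X A k a s i := c2.resolve_left (fun h => hN (e1.1 h))
      have g : Neg X A k a s n (i + 1) := by
        by_contra h
        exact e2 ⟨fun h' => absurd h' h, fun h' => absurd h' hN⟩
      have f2 : Pos X A k a s (n - (i + 1)) := c4.resolve_left (d1 g)
      intro p
      fin_cases p
      · exact f1
      · exact f0
      · exact f2

def Good (A : Finset E2) (k a : ℕ) (X : Finset E2) (F : Finset (Finset E2)) : Prop :=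
  (∀ P ∈ F, P ⊆ X ∧ P.card = k ∧ ((P ∩ A).card = a ∨ (P ∩ A).card = a + 1)) ∧
  (∀ x ∈ X, ∃ P ∈ F, x ∈ P) ∧
  ∀ P ∈ F, ∀ Q ∈ F, P ≠ Q → Disjoint (convexHull ℝ (P : Set E2)) (convexHull ℝ (Q : Set E2))

lemma good_biUnion {A : Finset E2} {k a : ℕ} {ι : Type*} [Fintype ι] (X : Finset E2)
    (Y : ι → Finset E2) (F : ι → Finset (Finset E2)) (hF : ∀ i, Good A k a (Y i) (F i))
    (hY : ∀ i, Y i ⊆ X) (hcov : ∀ x ∈ X, ∃ i, x ∈ Y i)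
    (hd : ∀ i j, i ≠ j → Disjoint (convexHull ℝ (Y i : Set E2)) (convexHull ℝ (Y j : Set E2))) :
    ∃ G, Good A k a X G := by
  classical
  refine ⟨Finset.univ.biUnion F, ?_, ?_, ?_⟩
  · intro P hP
    obtain ⟨i, -, hi⟩ := Finset.mem_biUnion.1 hP
    obtain ⟨h1, h2⟩ := (hF i).1 P hi
    exact ⟨h1.trans (hY i), h2⟩
  · intro x hx
    obtain ⟨i, hi⟩ := hcov x hx
    obtain ⟨P, hP, hxP⟩ := (hF i).2.1 x hi
    exact ⟨P, Finset.mem_biUnion.2 ⟨i, Finset.mem_univ _, hP⟩, hxP⟩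
  · intro P hP Q hQ hPQ
    obtain ⟨i, -, hi⟩ := Finset.mem_biUnion.1 hP
    obtain ⟨j, -, hj⟩ := Finset.mem_biUnion.1 hQ
    by_cases hij : i = j
    · subst hij
      exact (hF i).2.2 P hi Q hj hPQ
    · refine Set.disjoint_of_subset (convexHull_mono ?_) (convexHull_mono ?_) (hd i j hij)
      · exact_mod_cast ((hF i).1 P hi).1
      · exact_mod_cast ((hF j).1 Q hj).1

lemma genpos_mono {X Y : Finset E2} (h : GenPos 2 X) (hY : Y ⊆ X) : GenPos 2 Y :=
  fun S hS hc => h S (hS.trans hY) hc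

lemma main_ind (A : Finset E2) (k a : ℕ) : ∀ n : ℕ, 1 ≤ n → ∀ (X : Finset E2) (s : ℕ), GenPos 2 X →
    X.card = n * k → (X ∩ A).card = n * a + s → s ≤ n → ∃ F, Good A k a X F := by
  intro n
  induction n using Nat.strong_induction_on with
  | _ n ih =>
    intro hn X s hgp hX hXA hs
    by_cases hn2 : 2 ≤ n
    · rcases step hgp hn2 hs hX hXA with h | h
      · obtain ⟨m, e, hm, hmn, he, hes, hse, u, hu, H, hH, hc, hcA⟩ := h
        obtain ⟨h3, h4, h5⟩ := compl_half hX hXA hmn hH hc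
        obtain ⟨F1, hF1⟩ := ih m hmn hm H e (genpos_mono hgp hH.1) hc hcA he
        obtain ⟨F2, hF2⟩ := ih (n - m) (by omega) (by omega) (X \ H) (s - e)
          (genpos_mono hgp Finset.sdiff_subset) h4 (by omega) (by omega)
        have hsep := half_sep hgp hu hH
        refine good_biUnion (ι := Fin 2) X ![H, X \ H] ![F1, F2] ?_ ?_ ?_ ?_
        · intro i; fin_cases i
          · exact hF1
          · exact hF2
        · intro i; fin_cases i
          · exact hH.1
          · exact Finset.sdiff_subset
        · intro x hx
          by_cases hxH : x ∈ H
          · exact ⟨0, hxH⟩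
          · exact ⟨1, Finset.mem_sdiff.2 ⟨hx, hxH⟩⟩
        · intro i j hij
          fin_cases i <;> fin_cases j
          · exact absurd rfl hij
          · exact hsep
          · exact hsep.symm
          · exact absurd rfl hij
      · obtain ⟨m, T, hm1, hm, hT1, hT, v, f, hv, hf, hcnt⟩ := h
        have hmlt : ∀ p, m p < n := by
          intro p
          have h0 := hm1 0
          have h1 := hm1 1
          have h2 := hm1 2
          fin_cases p <;> simp <;> omega
        have hF : ∀ p, ∃ F, Good A k a (part f p) F := fun p =>
          ih (m p) (hmlt p) (hm1 p) (part f p) (T p) (genpos_mono hgp (part_subset f p))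
            (card_part f hf.1 p) (hcnt p) (hT1 p)
        choose F hF using hF
        refine good_biUnion X (part f) F hF (part_subset f) ?_ ?_
        · intro x hx
          exact ⟨f ⟨x, hx⟩, (mem_part f _ x).2 ⟨hx, rfl⟩⟩
        · intro p q hpq
          refine sep hgp (part_subset f p) (part_subset f q) (part_disjoint f hpq)
            (u := v p - v q) (sub_ne_zero.2 (hv.ne hpq)) ?_
          intro x hx y hy
          obtain ⟨hxX, rfl⟩ := (mem_part f p x).1 hx
          obtain ⟨hyX, rfl⟩ := (mem_part f q y).1 hy
          exact hf.swap ⟨x, hxX⟩ ⟨y, hyX⟩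
    · obtain rfl : n = 1 := by omega
      refine ⟨{X}, ?_, ?_, ?_⟩
      · intro P hP
        rw [Finset.mem_singleton] at hP
        subst hP
        exact ⟨subset_rfl, by omega, by omega⟩
      · intro x hx
        exact ⟨X, by simp, hx⟩
      · intro P hP Q hQ hPQ
        rw [Finset.mem_singleton] at hP hQ
        exact absurd (hP.trans hQ.symm) hPQ

end NEP

namespace NEP

lemma good_count {A X : Finset E2} {k a : ℕ} {F : Finset (Finset E2)} (h : Good A k a X F) :
    F.card * k = X.card ∧
    (F.filter (fun P => (P ∩ A).card = a + 1)).card * (a + 1) +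
      (F.filter (fun P => (P ∩ A).card = a)).card * a = (X ∩ A).card ∧
    (F.filter (fun P => (P ∩ A).card = a + 1)).card +
      (F.filter (fun P => (P ∩ A).card = a)).card = F.card := by
  have hdisj : ∀ P ∈ F, ∀ Q ∈ F, P ≠ Q → Disjoint P Q := by
    intro P hP Q hQ hPQ
    have h1 := Set.disjoint_of_subset (subset_convexHull ℝ (P : Set E2)) (subset_convexHull ℝ (Q : Set E2))
      (h.2.2 P hP Q hQ hPQ)
    exact_mod_cast h1
  have hU : X = F.biUnion (fun P => P) := by
    ext x
    simp only [Finset.mem_biUnion]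
    exact ⟨h.2.1 x, fun ⟨P, hP, hx⟩ => (h.1 P hP).1 hx⟩
  have hUA : X ∩ A = F.biUnion (fun P => P ∩ A) := by
    ext x
    simp only [Finset.mem_biUnion, Finset.mem_inter]
    constructor
    · rintro ⟨hx, hA⟩
      obtain ⟨P, hP, hxP⟩ := h.2.1 x hx
      exact ⟨P, hP, hxP, hA⟩
    · rintro ⟨P, hP, hx, hA⟩
      exact ⟨(h.1 P hP).1 hx, hA⟩
  have hfil : F.filter (fun P => ¬ (P ∩ A).card = a + 1) = F.filter (fun P => (P ∩ A).card = a) := by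
    apply Finset.filter_congr
    intro P hP
    have := (h.1 P hP).2.2
    omega
  refine ⟨?_, ?_, ?_⟩
  · rw [hU, Finset.card_biUnion (fun P hP Q hQ hPQ => hdisj P hP Q hQ hPQ)]
    rw [Finset.sum_congr rfl (fun P hP => (h.1 P hP).2.1), Finset.sum_const, smul_eq_mul]
  · rw [hUA, Finset.card_biUnion (fun P hP Q hQ hPQ =>
      Finset.disjoint_of_subset_left Finset.inter_subset_left
        (Finset.disjoint_of_subset_right Finset.inter_subset_left (hdisj P hP Q hQ hPQ))),
      ← Finset.sum_filter_add_sum_filter_not F (fun P => (P ∩ A).card = a + 1), hfil]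
    congr 1
    · rw [Finset.sum_congr rfl (fun P hP => (Finset.mem_filter.1 hP).2), Finset.sum_const, smul_eq_mul]
    · rw [Finset.sum_congr rfl (fun P hP => (Finset.mem_filter.1 hP).2), Finset.sum_const, smul_eq_mul]
  · rw [← hfil]
    exact Finset.card_filter_add_card_filter_not _

end NEP

namespace NEP

theorem final
    (a b s t n k : ℕ) (ha : 1 ≤ a) (hb : 1 ≤ b) (hs : 1 ≤ s) (ht : 1 ≤ t)
    (hn : 1 ≤ n) (hst : s + t = n) (hk : k = a + b + 1)
    (A B X : Finset E2)
    (hAB : Disjoint A B) (hX : X = A ∪ B)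
    (hgp : GenPos 2 X)
    (hA : A.card = n * a + s) (hB : B.card = n * b + t) :
    ∃ (C : Fin s → Finset E2)
      (D : Fin t → Finset E2),
      (∀ j, C j ⊆ X) ∧ (∀ i, D i ⊆ X) ∧
      (∀ j, (C j).card = k) ∧ (∀ i, (D i).card = k) ∧
      (∀ j, (X : Set E2) ∩ convexHull ℝ ((C j : Set E2))
          = (C j : Set E2)) ∧
      (∀ i, (X : Set E2) ∩ convexHull ℝ ((D i : Set E2))
          = (D i : Set E2)) ∧
      (∀ j, (C j ∩ A).card = a + 1) ∧ (∀ j, (C j ∩ B).card = b) ∧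
      (∀ i, (D i ∩ A).card = a) ∧ (∀ i, (D i ∩ B).card = b + 1) ∧
      (∀ j j', j ≠ j' →
        Disjoint (convexHull ℝ ((C j : Set E2)))
          (convexHull ℝ ((C j' : Set E2)))) ∧
      (∀ i i', i ≠ i' →
        Disjoint (convexHull ℝ ((D i : Set E2)))
          (convexHull ℝ ((D i' : Set E2)))) ∧
      (∀ j i,
        Disjoint (convexHull ℝ ((C j : Set E2)))
          (convexHull ℝ ((D i : Set E2)))) := by
  have hk0 : 0 < k := by omega
  have hXA : X ∩ A = A := by rw [hX]; exact Finset.inter_eq_right.2 Finset.subset_union_left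
  have hXc : X.card = n * k := by
    rw [hX, Finset.card_union_of_disjoint hAB, hA, hB, hk, ← hst]; ring
  obtain ⟨F, hF⟩ := NEP.main_ind A k a n hn X s hgp hXc (by rw [hXA, hA]) (by omega)
  obtain ⟨h1, h2, h3⟩ := NEP.good_count hF
  have hFn : F.card = n := Nat.eq_of_mul_eq_mul_right hk0 (h1.trans hXc)
  rw [hXA, hA] at h2
  rw [hFn] at h3
  have hcs : (F.filter (fun P => (P ∩ A).card = a + 1)).card = s := by
    rw [Nat.mul_succ, add_right_comm, ← Nat.add_mul, h3] at h2
    omega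
  have hct : (F.filter (fun P => (P ∩ A).card = a)).card = t := by omega
  let eC := (Finset.equivFinOfCardEq hcs).symm
  let eD := (Finset.equivFinOfCardEq hct).symm
  have mC : ∀ j, (eC j : Finset E2) ∈ F ∧
      ((eC j : Finset E2) ∩ A).card = a + 1 :=
    fun j => Finset.mem_filter.1 (eC j).2
  have mD : ∀ j, (eD j : Finset E2) ∈ F ∧
      ((eD j : Finset E2) ∩ A).card = a :=
    fun j => Finset.mem_filter.1 (eD j).2
  have isl : ∀ P ∈ F, (X : Set E2) ∩
      convexHull ℝ (P : Set E2) = (P : Set E2) := by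
    intro P hP
    apply Set.Subset.antisymm
    · rintro x ⟨hx, hxP⟩
      obtain ⟨Q, hQ, hxQ⟩ := hF.2.1 x hx
      by_cases hPQ : P = Q
      · rw [hPQ]; exact hxQ
      · exact absurd (subset_convexHull ℝ _ (Finset.mem_coe.2 hxQ))
          (Set.disjoint_left.1 (hF.2.2 P hP Q hQ hPQ) hxP)
    · intro x hx
      exact ⟨(hF.1 P hP).1 hx, subset_convexHull ℝ _ hx⟩
  have hcB : ∀ P ∈ F, (P ∩ A).card + (P ∩ B).card = a + b + 1 := by
    intro P hP
    obtain ⟨hPX, hPk, -⟩ := hF.1 P hP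
    rw [← hk, ← hPk, ← Finset.card_union_of_disjoint, ← Finset.inter_union_distrib_left, ← hX,
      Finset.inter_eq_left.2 hPX]
    exact Finset.disjoint_of_subset_left Finset.inter_subset_right
      (Finset.disjoint_of_subset_right Finset.inter_subset_right hAB)
  refine ⟨fun j => eC j, fun i => eD i, fun j => (hF.1 _ (mC j).1).1, fun i => (hF.1 _ (mD i).1).1,
    fun j => (hF.1 _ (mC j).1).2.1, fun i => (hF.1 _ (mD i).1).2.1,
    fun j => isl _ (mC j).1, fun i => isl _ (mD i).1,
    fun j => (mC j).2, fun j => ?_, fun i => (mD i).2, fun i => ?_, ?_, ?_, ?_⟩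
  · have := hcB _ (mC j).1
    have := (mC j).2
    simp only
    omega
  · have := hcB _ (mD i).1
    have := (mD i).2
    simp only
    omega
  · intro j j' hjj
    exact hF.2.2 _ (mC j).1 _ (mC j').1 (fun h => hjj (eC.injective (Subtype.ext h)))
  · intro j j' hjj
    exact hF.2.2 _ (mD j).1 _ (mD j').1 (fun h => hjj (eD.injective (Subtype.ext h)))
  · intro j i
    refine hF.2.2 _ (mC j).1 _ (mD i).1 (fun h => ?_)
    have h4 := (mC j).2
    have h5 := (mD i).2
    have h6 : ((eC j : Finset E2) ∩ A).card = ((eD i : Finset E2) ∩ A).card :=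
      congrArg (fun P : Finset E2 => (P ∩ A).card) h
    rw [h4, h5] at h6
    omega

end NEP

theorem near_equipartition_plane_refined
    (a b s t n k : ℕ) (ha : 1 ≤ a) (hb : 1 ≤ b) (hs : 1 ≤ s) (ht : 1 ≤ t)
    (hn : 1 ≤ n) (hst : s + t = n) (hk : k = a + b + 1)
    (A B X : Finset (EuclideanSpace ℝ (Fin 2)))
    (hAB : Disjoint A B) (hX : X = A ∪ B)
    (hgp : GenPos 2 X)
    (hA : A.card = n * a + s) (hB : B.card = n * b + t) :
    ∃ (C : Fin s → Finset (EuclideanSpace ℝ (Fin 2)))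
      (D : Fin t → Finset (EuclideanSpace ℝ (Fin 2))),
      (∀ j, C j ⊆ X) ∧ (∀ i, D i ⊆ X) ∧
      (∀ j, (C j).card = k) ∧ (∀ i, (D i).card = k) ∧
      (∀ j, (X : Set (EuclideanSpace ℝ (Fin 2))) ∩ convexHull ℝ ((C j : Set (EuclideanSpace ℝ (Fin 2))))
          = (C j : Set (EuclideanSpace ℝ (Fin 2)))) ∧
      (∀ i, (X : Set (EuclideanSpace ℝ (Fin 2))) ∩ convexHull ℝ ((D i : Set (EuclideanSpace ℝ (Fin 2))))
          = (D i : Set (EuclideanSpace ℝ (Fin 2)))) ∧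
      (∀ j, (C j ∩ A).card = a + 1) ∧ (∀ j, (C j ∩ B).card = b) ∧
      (∀ i, (D i ∩ A).card = a) ∧ (∀ i, (D i ∩ B).card = b + 1) ∧
      (∀ j j', j ≠ j' →
        Disjoint (convexHull ℝ ((C j : Set (EuclideanSpace ℝ (Fin 2)))))
          (convexHull ℝ ((C j' : Set (EuclideanSpace ℝ (Fin 2)))))) ∧
      (∀ i i', i ≠ i' →
        Disjoint (convexHull ℝ ((D i : Set (EuclideanSpace ℝ (Fin 2)))))
          (convexHull ℝ ((D i' : Set (EuclideanSpace ℝ (Fin 2)))))) ∧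
      (∀ j i,
        Disjoint (convexHull ℝ ((C j : Set (EuclideanSpace ℝ (Fin 2)))))
          (convexHull ℝ ((D i : Set (EuclideanSpace ℝ (Fin 2)))))) := by
  exact NEP.final a b s t n k ha hb hs ht hn hst hk A B X hAB hX hgp hA hB
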